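/- Assume the hypotheses guaranteeing the minimal speed c_*(h) for h ∈ [0,h_*] (conditions (U), min_{[0,κ]} g' = g'(κ) < 0, and the Hölder condition at 0), and take c > c_*(h) with h ∈ [0,h_*]. Then the wavefront profile φ_c of speed c satisfies, for an appropriate s₀ ∈ ℝ and some σ > 0: φ_c(t+s₀) = e^{λ₂ t} + O(e^{(λ₂+σ)t}) and φ_c'(t+s₀) = λ₂ e^{λ₂ t} + O(e^{(λ₂+σ)t}) as t → −∞, where λ₂ = λ₂(c) is the smaller positive root of χ(z,c) = z² − cz − 1 + g'(0)e^{−zch} = 0. -/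

import Mathlib

open Filter Set Asymptotics

noncomputable section

/-- The wave profile equation `φ'' - cφ' - φ + g(φ(· - ch)) = 0`. -/
def ProfileEq (g : ℝ → ℝ) (c h : ℝ) (φ : ℝ → ℝ) : Prop :=
  ∀ t : ℝ, deriv (deriv φ) t - c * deriv φ t - φ t + g (φ (t - c * h)) = 0

/-- A wavefront profile of speed `c`: positive, `C²`, solving the profile equation,
with `φ(-∞) = 0` and `φ(+∞) = κ`. -/
def Wavefront (g : ℝ → ℝ) (κ c h : ℝ) (φ : ℝ → ℝ) : Prop :=
  (∀ t, 0 < φ t) ∧ ContDiff ℝ 2 φ ∧ ProfileEq g c h φ ∧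
    Tendsto φ atBot (nhds 0) ∧ Tendsto φ atTop (nhds κ)

/-- The characteristic function `χ(z,c) = z² - cz - 1 + b e^{-zch}` at the zero
equilibrium, where `b = g'(0)`. -/
def chi0 (b c h z : ℝ) : ℝ := z ^ 2 - c * z - 1 + b * Real.exp (-(z * c * h))


theorem nf_mono {F F' : ℝ → ℝ} {D : Set ℝ} (hD : Convex ℝ D) (h : ∀ s, HasDerivAt F (F' s) s)
    (h0 : ∀ s ∈ D, 0 ≤ F' s) : MonotoneOn F D := by
  apply monotoneOn_of_deriv_nonneg hD
  · exact fun s _ => (h s).continuousAt.continuousWithinAt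
  · exact fun s _ => (h s).differentiableAt.differentiableWithinAt
  · intro s hs
    rw [(h s).deriv]
    exact h0 s (interior_subset hs)

theorem nf_anti {F F' : ℝ → ℝ} {D : Set ℝ} (hD : Convex ℝ D) (h : ∀ s, HasDerivAt F (F' s) s)
    (h0 : ∀ s ∈ D, F' s ≤ 0) : AntitoneOn F D := by
  apply antitoneOn_of_deriv_nonpos hD
  · exact fun s _ => (h s).continuousAt.continuousWithinAt
  · exact fun s _ => (h s).differentiableAt.differentiableWithinAt
  · intro s hs
    rw [(h s).deriv]
    exact h0 s (interior_subset hs)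

theorem nf_santi {F F' : ℝ → ℝ} {D : Set ℝ} (hD : Convex ℝ D) (h : ∀ s, HasDerivAt F (F' s) s)
    (h0 : ∀ s ∈ D, F' s < 0) : StrictAntiOn F D := by
  apply strictAntiOn_of_deriv_neg hD
  · exact fun s _ => (h s).continuousAt.continuousWithinAt
  · intro s hs
    rw [(h s).deriv]
    exact h0 s (interior_subset hs)

theorem nf_exp_deriv (a : ℝ) (s : ℝ) :
    HasDerivAt (fun t => Real.exp (a * t)) (a * Real.exp (a * s)) s := by
  have := ((hasDerivAt_id s).const_mul a).exp
  simpa [mul_comm] using this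

theorem nf_first_zero {f : ℝ → ℝ} (hf : Continuous f) {T0 t : ℝ} (h0 : ∀ s ≤ T0, 0 < f s)
    (ht : f t ≤ 0) : ∃ t1, t1 ≤ t ∧ f t1 = 0 ∧ ∀ s < t1, 0 < f s := by
  have hcl : IsClosed {s | f s ≤ 0} := isClosed_le hf continuous_const
  have hbd : BddBelow {s | f s ≤ 0} := ⟨T0, fun s hs => by
    by_contra hlt
    exact absurd (h0 s (not_le.mp hlt).le) (not_lt.mpr hs)⟩
  have hne : {s | f s ≤ 0}.Nonempty := ⟨t, ht⟩
  have hm := hcl.csInf_mem hne hbd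
  set t1 := sInf {s | f s ≤ 0}
  have hlt : ∀ s < t1, 0 < f s := fun s hs => by
    by_contra hh
    exact absurd (csInf_le hbd (show s ∈ {s | f s ≤ 0} from not_lt.mp hh)) (not_le.mpr hs)
  refine ⟨t1, csInf_le hbd ht, le_antisymm hm ?_, hlt⟩
  have : Tendsto f (nhdsWithin t1 (Iio t1)) (nhds (f t1)) := hf.continuousAt.mono_left nhdsWithin_le_nhds
  exact ge_of_tendsto this (by filter_upwards [self_mem_nhdsWithin] with s hs using (hlt s hs).le)

/-- forward version: from a point where `f < 0`. -/
theorem nf_first_zero' {f : ℝ → ℝ} (hf : Continuous f) {a t : ℝ} (ha : f a < 0) (hat : a ≤ t)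
    (ht : 0 ≤ f t) : ∃ t1, a < t1 ∧ f t1 = 0 ∧ ∀ s, a ≤ s → s < t1 → f s < 0 := by
  have hc : Continuous (fun s => - f (max s a)) := by fun_prop
  obtain ⟨t1, h1, h2, h3⟩ := nf_first_zero (f := fun s => - f (max s a)) hc (T0 := a) (t := t)
    (fun s hs => by simp [max_eq_right hs, ha]) (by simp [max_eq_left hat, ht])
  have hat1 : a < t1 := by
    by_contra hh
    simp only [max_eq_right (not_lt.mp hh)] at h2
    linarith
  refine ⟨t1, hat1, ?_, ?_⟩
  · simp only [max_eq_left hat1.le] at h2; linarith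
  · intro s hs hst
    have := h3 s hst
    simp only [max_eq_left hs] at this; linarith

theorem nf_win_lower {f f1 : ℝ → ℝ} (hf : ∀ t, HasDerivAt f (f1 t) t) {l μ m a t : ℝ}
    (hne : l ≠ μ) (hat : a ≤ t) (H : ∀ s ∈ Icc a t, m * Real.exp (μ * s) ≤ f1 s - l * f s) :
    m * Real.exp (μ * t) * ((Real.exp ((l - μ) * (t - a)) - 1) / (l - μ)) ≤
      f t - Real.exp (l * (t - a)) * f a := by
  have hne' : μ - l ≠ 0 := sub_ne_zero.mpr hne.symm
  have hne2 : l - μ ≠ 0 := sub_ne_zero.mpr hne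
  have hd : ∀ s, HasDerivAt (fun s => Real.exp (-l * s) * f s - m * Real.exp ((μ - l) * s) / (μ - l))
      (Real.exp (-l * s) * (f1 s - l * f s - m * Real.exp (μ * s))) s := by
    intro s
    have h1 := (nf_exp_deriv (-l) s).mul (hf s)
    have h2 := ((nf_exp_deriv (μ - l) s).const_mul m).div_const (μ - l)
    refine (h1.sub h2).congr_deriv ?_
    have : Real.exp ((μ - l) * s) = Real.exp (-l * s) * Real.exp (μ * s) := by
      rw [← Real.exp_add]; ring_nf
    rw [this]; field_simp; ring
  have hm := nf_mono (convex_Icc a t) hd (fun s hs => by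
    have := H s hs
    have := Real.exp_pos (-l * s)
    apply mul_nonneg this.le; linarith)
  have h3 := hm (left_mem_Icc.mpr hat) (right_mem_Icc.mpr hat) hat
  simp only at h3
  have e1 : Real.exp (l * t) * Real.exp (-l * t) = 1 := by rw [← Real.exp_add]; simp
  have e2 : Real.exp (l * t) * Real.exp (-l * a) = Real.exp (l * (t - a)) := by
    rw [← Real.exp_add]; ring_nf
  have e3 : Real.exp (l * t) * Real.exp ((μ - l) * t) = Real.exp (μ * t) := by
    rw [← Real.exp_add]; ring_nf
  have e4 : Real.exp (l * t) * Real.exp ((μ - l) * a) = Real.exp (μ * t) * Real.exp ((l - μ) * (t - a)) := by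
    rw [← Real.exp_add, ← Real.exp_add]; ring_nf
  have h4 := mul_le_mul_of_nonneg_left h3 (Real.exp_pos (l * t)).le
  have l1 : Real.exp (l * t) * (Real.exp (-l * a) * f a - m * Real.exp ((μ - l) * a) / (μ - l))
     = Real.exp (l * (t - a)) * f a - m * (Real.exp (μ * t) * Real.exp ((l - μ) * (t - a))) / (μ - l) := by
    rw [← e2, ← e4]; ring
  have l2 : Real.exp (l * t) * (Real.exp (-l * t) * f t - m * Real.exp ((μ - l) * t) / (μ - l))
     = f t - m * Real.exp (μ * t) / (μ - l) := by
    rw [← e3, mul_sub, ← mul_assoc, e1]; ring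
  rw [l1, l2] at h4
  have l3 : m * Real.exp (μ * t) * ((Real.exp ((l - μ) * (t - a)) - 1) / (l - μ)) =
    m * Real.exp (μ * t) / (μ - l) - m * (Real.exp (μ * t) * Real.exp ((l - μ) * (t - a))) / (μ - l) := by
    have : μ - l = -(l - μ) := by ring
    rw [this]; field_simp; ring
  rw [l3]; linarith

theorem nf_win_upper {f f1 : ℝ → ℝ} (hf : ∀ t, HasDerivAt f (f1 t) t) {l μ m a t : ℝ}
    (hne : l ≠ μ) (hat : a ≤ t) (H : ∀ s ∈ Icc a t, f1 s - l * f s ≤ m * Real.exp (μ * s)) :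
    f t - Real.exp (l * (t - a)) * f a ≤
    m * Real.exp (μ * t) * ((Real.exp ((l - μ) * (t - a)) - 1) / (l - μ)) := by
  have := nf_win_lower (f := fun s => - f s) (f1 := fun s => - f1 s) (fun s => (hf s).neg) (m := -m)
    hne hat (fun s hs => by have := H s hs; linarith)
  linarith

theorem nf_lim {f f1 : ℝ → ℝ} (hf : ∀ t, HasDerivAt f (f1 t) t) {C σ T : ℝ} (hσ : 0 < σ)
    (hb : ∀ t ≤ T, |f1 t| ≤ C * Real.exp (σ * t)) :
    ∃ L, ∀ t ≤ T, |f t - L| ≤ C / σ * Real.exp (σ * t) := by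
  have hd (e : ℝ) : ∀ s, HasDerivAt (fun s => f s + e * (C / σ * Real.exp (σ * s)))
      (f1 s + e * (C * Real.exp (σ * s))) s := by
    intro s
    refine ((hf s).add (((nf_exp_deriv σ s).const_mul (C / σ)).const_mul e)).congr_deriv ?_
    field_simp
  have hm := nf_mono (convex_Iic T) (hd 1) (fun s hs => by have := abs_le.mp (hb s hs); linarith)
  have ha := nf_anti (convex_Iic T) (hd (-1)) (fun s hs => by have := abs_le.mp (hb s hs); linarith)
  set L := sInf ((fun s => f s + 1 * (C / σ * Real.exp (σ * s))) '' Iic T) with hL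
  have hC : 0 ≤ C := by
    have := (abs_nonneg _).trans (hb T le_rfl)
    exact nonneg_of_mul_nonneg_left this (Real.exp_pos _)
  have hcross : ∀ s ≤ T, ∀ t ≤ T, f t + (-1) * (C / σ * Real.exp (σ * t)) ≤ f s + 1 * (C / σ * Real.exp (σ * s)) := by
    intro s hs t ht
    have p1 : 0 ≤ C / σ * Real.exp (σ * t) := by positivity
    have p2 : 0 ≤ C / σ * Real.exp (σ * s) := by positivity
    rcases le_total s t with hst | hst
    · have := ha (show s ∈ Iic T from hs) (show t ∈ Iic T from ht) hst
      simp only at this; linarith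
    · have := hm (show t ∈ Iic T from ht) (show s ∈ Iic T from hs) hst
      simp only at this; linarith
  refine ⟨L, fun t ht => ?_⟩
  have hbd : BddBelow ((fun s => f s + 1 * (C / σ * Real.exp (σ * s))) '' Iic T) :=
    ⟨f t + (-1) * (C / σ * Real.exp (σ * t)), by
      rintro _ ⟨s, hs, rfl⟩; exact hcross s hs t ht⟩
  have h1 : L ≤ f t + 1 * (C / σ * Real.exp (σ * t)) := csInf_le hbd ⟨t, ht, rfl⟩
  have h2 : f t + (-1) * (C / σ * Real.exp (σ * t)) ≤ L := by
    apply le_csInf (Set.nonempty_Iic.image _)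
    rintro _ ⟨s, hs, rfl⟩; exact hcross s hs t ht
  rw [abs_le]; constructor <;> linarith


theorem nf_left_lt {F : ℝ → ℝ} {d t a : ℝ} (hF : HasDerivAt F d t) (hd : 0 < d) (ha : a < t) :
    ∃ s ∈ Ioo a t, F s < F t := by
  have h1 := (hasDerivAt_iff_tendsto_slope.mp hF).mono_left
    (nhdsWithin_mono t (show Iio t ⊆ {t}ᶜ from fun x hx => ne_of_lt hx))
  have h2 := h1.eventually (lt_mem_nhds hd)
  obtain ⟨s, hs1, hs2⟩ := (h2.and (Ioo_mem_nhdsLT ha)).exists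
  refine ⟨s, hs2, ?_⟩
  rw [slope_def_field] at hs1
  have : s - t < 0 := by linarith [hs2.2]
  by_contra hh
  have : (F s - F t) / (s - t) ≤ 0 := div_nonpos_of_nonneg_of_nonpos (by linarith) this.le
  linarith

theorem nf_inv {U U1 Z : ℝ → ℝ} (hU : ∀ t, HasDerivAt U (U1 t) t) {κ τ T t0 m E ℓ : ℝ}
    (hτℓ : τ ≤ ℓ) (hE : 0 ≤ E)
    (hZ : ∀ t ≤ T, ∀ m', (∀ s ∈ Icc (t - τ) t, m' ≤ U s) → κ * m' ≤ Z t)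
    (hU1 : ∀ t, t0 ≤ t → t ≤ T → -κ * U t + Z t - E ≤ U1 t) (hℓ : 0 ≤ ℓ)
    (hw : ∀ s ∈ Icc (t0 - ℓ) t0, m ≤ U s) :
    ∀ t, t0 ≤ t → t ≤ T → m - E * (t - t0) ≤ U t := by
  intro t ht0 htT
  have key : ∀ ε > 0, m - (E + ε) * (t - t0) ≤ U t := by
    intro ε hε
    by_contra hlt
    push Not at hlt
    have hFd : ∀ s, HasDerivAt (fun s => U s + (E + ε) * (s - t0)) (U1 s + (E + ε)) s := fun s => by
      refine ((hU s).add (((hasDerivAt_id s).sub_const t0).const_mul (E + ε))).congr_deriv ?_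
      ring
    have hc : ContinuousOn (fun s => U s + (E + ε) * (s - t0)) (Icc t0 t) :=
      fun s _ => (hFd s).continuousAt.continuousWithinAt
    obtain ⟨x, hx, hmin⟩ := isCompact_Icc.exists_isMinOn (nonempty_Icc.mpr ht0) hc
    have hmin' : ∀ s ∈ Icc t0 t, U x + (E + ε) * (x - t0) ≤ U s + (E + ε) * (s - t0) := hmin
    have hxt := hmin' t (right_mem_Icc.mpr ht0)
    have hxm : U x + (E + ε) * (x - t0) < m := by linarith
    have hx0 : t0 < x := by
      rcases eq_or_lt_of_le hx.1 with h | h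
      · have := hw t0 ⟨by linarith, le_rfl⟩
        rw [← h] at hxm; simp at hxm; linarith
      · exact h
    have hUx : ∀ s ∈ Icc (x - τ) x, U x ≤ U s := by
      intro s hs
      rcases le_or_gt t0 s with h | h
      · have h1 := hmin' s ⟨h, hs.2.trans hx.2⟩
        nlinarith [hs.2]
      · have := hw s ⟨by linarith [hs.1], h.le⟩
        nlinarith
    have h1 := hZ x (hx.2.trans htT) _ hUx
    have h2 := hU1 x hx.1 (hx.2.trans htT)
    obtain ⟨s, hs, hs2⟩ := nf_left_lt (hFd x) (by linarith) hx0
    have := hmin' s ⟨hs.1.le, hs.2.le.trans hx.2⟩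
    linarith
  apply le_of_forall_pos_le_add
  intro ε hε
  have hp : 0 < t - t0 + 1 := by linarith
  have := key (ε / (t - t0 + 1)) (by positivity)
  have h2 : ε / (t - t0 + 1) * (t - t0) ≤ ε := by
    rw [div_mul_eq_mul_div, div_le_iff₀ hp]; nlinarith
  nlinarith

/-- if `U' ≥ -κ (U - m) - E` then decay is at most exponential -/
theorem nf_decay {U U1 : ℝ → ℝ} (hU : ∀ t, HasDerivAt U (U1 t) t) {κ m E t0 t : ℝ} (hκ : 0 ≤ κ)
    (hE : 0 ≤ E) (h : t0 ≤ t) (H : ∀ s ∈ Icc t0 t, -κ * (U s - m) - E ≤ U1 s) :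
    Real.exp (-κ * (t - t0)) * (U t0 - m) - E * (t - t0) ≤ U t - m := by
  have hd : ∀ s, HasDerivAt (fun s => Real.exp (κ * s) * (U s - m) + E * Real.exp (κ * t) * s)
      (Real.exp (κ * s) * (U1 s + κ * (U s - m)) + E * Real.exp (κ * t)) s := fun s => by
    refine (((nf_exp_deriv κ s).mul ((hU s).sub_const m)).add
      ((hasDerivAt_id s).const_mul (E * Real.exp (κ * t)))).congr_deriv ?_
    ring
  have hm := nf_mono (convex_Icc t0 t) hd (fun s hs => by
    have h1 := H s hs
    have h2 : Real.exp (κ * s) ≤ Real.exp (κ * t) := Real.exp_le_exp.mpr (by nlinarith [hs.2])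
    have h3 := Real.exp_pos (κ * s)
    nlinarith)
  have h3 := hm (left_mem_Icc.mpr h) (right_mem_Icc.mpr h) h
  simp only at h3
  have h4 := mul_le_mul_of_nonneg_left h3 (Real.exp_pos (-κ * t)).le
  have e1 : Real.exp (-κ * t) * Real.exp (κ * t) = 1 := by rw [← Real.exp_add]; simp
  have e2 : Real.exp (-κ * t) * Real.exp (κ * t0) = Real.exp (-κ * (t - t0)) := by
    rw [← Real.exp_add]; ring_nf
  rw [← e2]
  calc _ = Real.exp (-κ * t) * (Real.exp (κ * t0) * (U t0 - m) + E * Real.exp (κ * t) * t0) - E * t := by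
        linear_combination (-E * t0) * e1
    _ ≤ Real.exp (-κ * t) * (Real.exp (κ * t) * (U t - m) + E * Real.exp (κ * t) * t) - E * t := by linarith
    _ = _ := by linear_combination (U t - m + E * t) * e1

/-- one step of oscillation reduction, in the case `U t0` is in the upper half. -/
theorem nf_step {U U1 Z : ℝ → ℝ} (hU : ∀ t, HasDerivAt U (U1 t) t) {κ τ T t0 m M E ℓ : ℝ}
    (hκ : 0 ≤ κ) (hτℓ : τ ≤ ℓ) (hℓ : 0 ≤ ℓ) (hE : 0 ≤ E)
    (hZ : ∀ t ≤ T, ∀ m', (∀ s ∈ Icc (t - τ) t, m' ≤ U s) → κ * m' ≤ Z t)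
    (hZ' : ∀ t ≤ T, ∀ m', (∀ s ∈ Icc (t - τ) t, U s ≤ m') → Z t ≤ κ * m')
    (hU1 : ∀ t, t0 ≤ t → t ≤ T → |U1 t - (-κ * U t + Z t)| ≤ E)
    (hT : t0 + ℓ ≤ T)
    (hwm : ∀ s ∈ Icc (t0 - ℓ) t0, m ≤ U s) (hwM : ∀ s ∈ Icc (t0 - ℓ) t0, U s ≤ M)
    (hmid : (m + M) / 2 ≤ U t0) :
    ∀ x ∈ Icc t0 (t0 + ℓ), ∀ y ∈ Icc t0 (t0 + ℓ),
      U x - U y ≤ (1 - Real.exp (-κ * ℓ) / 2) * (M - m) + 3 * ℓ * E := by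
  intro x hx y hy
  have hup := nf_inv (U := fun s => - U s) (U1 := fun s => - U1 s) (Z := fun s => - Z s)
    (fun s => (hU s).neg) (κ := κ) (τ := τ) (T := T) (t0 := t0) (m := -M) (E := E) (ℓ := ℓ) hτℓ hE
    (fun t ht m' hm' => by
      have := hZ' t ht (-m') (fun s hs => by have := hm' s hs; linarith)
      linarith)
    (fun t h1 h2 => by have := abs_le.mp (hU1 t h1 h2); linarith) hℓ
    (fun s hs => by have := hwM s hs; linarith)
  have hlo := nf_inv hU (κ := κ) (τ := τ) (T := T) (t0 := t0) (m := m) (E := E) (ℓ := ℓ) hτℓ hE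
    hZ (fun t h1 h2 => by have := abs_le.mp (hU1 t h1 h2); linarith) hℓ hwm
  have hux := hup x hx.1 (hx.2.trans hT)
  have hb : ∀ s ∈ Icc (t0 - ℓ) (t0 + ℓ), m - E * ℓ ≤ U s := by
    intro s hs
    rcases le_total s t0 with h | h
    · have := hwm s ⟨hs.1, h⟩
      nlinarith
    · have := hlo s h (hs.2.trans hT)
      nlinarith [hs.2]
  have hdec := nf_decay hU (m := m - E * ℓ) (E := E) (t0 := t0) (t := y) hκ hE hy.1 (fun s hs => by
    have h1 := hZ s ((hs.2.trans hy.2).trans hT) (m - E * ℓ) (fun r hr => hb r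
      ⟨by linarith [hr.1, hs.1], by linarith [hr.2, hs.2, hy.2]⟩)
    have h2 := abs_le.mp (hU1 s hs.1 ((hs.2.trans hy.2).trans hT))
    linarith)
  have hmM : m ≤ M := (hwm t0 ⟨by linarith, le_rfl⟩).trans (hwM t0 ⟨by linarith, le_rfl⟩)
  have he : Real.exp (-κ * ℓ) ≤ Real.exp (-κ * (y - t0)) := by
    apply Real.exp_le_exp.mpr; nlinarith [hy.2]
  have he0 := Real.exp_pos (-κ * ℓ)
  have h5 : Real.exp (-κ * ℓ) * ((M - m) / 2) ≤ Real.exp (-κ * (y - t0)) * (U t0 - (m - E * ℓ)) := by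
    apply mul_le_mul he _ (by linarith) (Real.exp_pos _).le
    nlinarith
  have h6 : E * (y - t0) ≤ E * ℓ := by nlinarith [hy.2]
  have h7 : E * (x - t0) ≤ E * ℓ := by nlinarith [hx.2]
  linarith

theorem nf_step2 {U U1 Z : ℝ → ℝ} (hU : ∀ t, HasDerivAt U (U1 t) t) {κ τ T t0 d E ℓ : ℝ}
    (hκ : 0 ≤ κ) (hτℓ : τ ≤ ℓ) (hℓ : 0 ≤ ℓ) (hE : 0 ≤ E)
    (hZ : ∀ t ≤ T, ∀ m', (∀ s ∈ Icc (t - τ) t, m' ≤ U s) → κ * m' ≤ Z t)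
    (hZ' : ∀ t ≤ T, ∀ m', (∀ s ∈ Icc (t - τ) t, U s ≤ m') → Z t ≤ κ * m')
    (hU1 : ∀ t, t0 ≤ t → t ≤ T → |U1 t - (-κ * U t + Z t)| ≤ E)
    (hT : t0 + ℓ ≤ T)
    (hosc : ∀ x ∈ Icc (t0 - ℓ) t0, ∀ y ∈ Icc (t0 - ℓ) t0, U x - U y ≤ d) :
    ∀ x ∈ Icc t0 (t0 + ℓ), ∀ y ∈ Icc t0 (t0 + ℓ),
      U x - U y ≤ (1 - Real.exp (-κ * ℓ) / 2) * d + 3 * ℓ * E := by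
  have hc : ContinuousOn U (Icc (t0 - ℓ) t0) := fun s _ => (hU s).continuousAt.continuousWithinAt
  have hne : (Icc (t0 - ℓ) t0).Nonempty := nonempty_Icc.mpr (by linarith)
  obtain ⟨a, ha, hmin⟩ := isCompact_Icc.exists_isMinOn hne hc
  obtain ⟨b, hb, hmax⟩ := isCompact_Icc.exists_isMaxOn hne hc
  have hmin' : ∀ s ∈ Icc (t0 - ℓ) t0, U a ≤ U s := hmin
  have hmax' : ∀ s ∈ Icc (t0 - ℓ) t0, U s ≤ U b := hmax
  have hd := hosc b hb a ha
  have he : Real.exp (-κ * ℓ) ≤ 1 := Real.exp_le_one_iff.mpr (by nlinarith)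
  have hfin : (1 - Real.exp (-κ * ℓ) / 2) * (U b - U a) ≤ (1 - Real.exp (-κ * ℓ) / 2) * d :=
    mul_le_mul_of_nonneg_left hd (by linarith)
  intro x hx y hy
  rcases le_total ((U a + U b) / 2) (U t0) with h | h
  · have := nf_step hU hκ hτℓ hℓ hE hZ hZ' hU1 hT hmin' hmax' h x hx y hy
    linarith
  · have := nf_step (U := fun s => - U s) (U1 := fun s => - U1 s) (Z := fun s => - Z s)
      (fun s => (hU s).neg) (m := - U b) (M := - U a) hκ hτℓ hℓ hE
      (fun t ht m' hm' => by
        have := hZ' t ht (-m') (fun s hs => by have := hm' s hs; linarith)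
        linarith)
      (fun t ht m' hm' => by
        have := hZ t ht (-m') (fun s hs => by have := hm' s hs; linarith)
        linarith)
      (fun t h1 h2 => by
        have := hU1 t h1 h2
        rw [← abs_neg] at this
        convert this using 2; ring) hT
      (fun s hs => by have := hmax' s hs; linarith) (fun s hs => by have := hmin' s hs; linarith)
      (by linarith) y hy x hx
    linarith

theorem nf_osc {U U1 Z : ℝ → ℝ} (hU : ∀ t, HasDerivAt U (U1 t) t) {κ τ T ℓ C C0 σ η : ℝ}
    (hκ : 0 ≤ κ) (hτ : 0 ≤ τ) (hτℓ : τ ≤ ℓ) (hℓ : 0 ≤ ℓ) (hC : 0 ≤ C) (hσ : 0 < σ)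
    (hZ : ∀ t ≤ T, ∀ m', (∀ s ∈ Icc (t - τ) t, m' ≤ U s) → κ * m' ≤ Z t)
    (hZ' : ∀ t ≤ T, ∀ m', (∀ s ∈ Icc (t - τ) t, U s ≤ m') → Z t ≤ κ * m')
    (hU1 : ∀ t ≤ T, |U1 t - (-κ * U t + Z t)| ≤ C * Real.exp (σ * t))
    (hgr : ∀ t ≤ T, |U t| ≤ C0 * Real.exp (-η * t)) (hη : 0 ≤ η)
    (hηθ : (1 - Real.exp (-κ * ℓ) / 2) * Real.exp (η * ℓ) < 1) :
    ∃ L C', ∀ t ≤ T, |U t - L| ≤ C' * Real.exp (σ * t) := by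
  set θ := 1 - Real.exp (-κ * ℓ) / 2 with hθ
  have he : Real.exp (-κ * ℓ) ≤ 1 := Real.exp_le_one_iff.mpr (by nlinarith)
  have he0 := Real.exp_pos (-κ * ℓ)
  have hθ0 : 0 ≤ θ := by linarith
  have hθ1 : θ < 1 := by linarith
  set D := 3 * ℓ * C / (1 - θ) with hD
  have hD0 : 0 ≤ D := by apply div_nonneg (by positivity); linarith
  have hDθ : θ * D + 3 * ℓ * C = D := by
    have : 1 - θ ≠ 0 := by linarith
    rw [hD]; field_simp; ring
  have hC0 : 0 ≤ C0 := by
    have := (abs_nonneg _).trans (hgr T le_rfl)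
    exact nonneg_of_mul_nonneg_left this (Real.exp_pos _)
  have main : ∀ n : ℕ, ∀ t ≤ T, ∀ x ∈ Icc (t - ℓ) t, ∀ y ∈ Icc (t - ℓ) t,
      U x - U y ≤ θ ^ n * (2 * C0 * Real.exp (-η * (t - (n + 1) * ℓ))) + D * Real.exp (σ * t) := by
    intro n
    induction n with
    | zero =>
      intro t ht x hx y hy
      have h1 := abs_le.mp (hgr x (hx.2.trans ht))
      have h2 := abs_le.mp (hgr y (hy.2.trans ht))
      have h3 : ∀ x ∈ Icc (t - ℓ) t, C0 * Real.exp (-η * x) ≤ C0 * Real.exp (-η * (t - ℓ)) := fun x hx => by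
        apply mul_le_mul_of_nonneg_left _ hC0
        apply Real.exp_le_exp.mpr; nlinarith [hx.1]
      have h4 := h3 x hx
      have h5 := h3 y hy
      have h6 : 0 ≤ D * Real.exp (σ * t) := by positivity
      simp only [Nat.cast_zero, zero_add, one_mul, pow_zero]
      linarith
    | succ n ih =>
      intro t ht x hx y hy
      have := nf_step2 hU (t0 := t - ℓ) (E := C * Real.exp (σ * t)) (T := t) hκ hτℓ hℓ (by positivity)
        (fun s hs => hZ s (hs.trans ht)) (fun s hs => hZ' s (hs.trans ht))
        (fun s h1 h2 => (hU1 s (h2.trans ht)).trans (by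
          apply mul_le_mul_of_nonneg_left _ hC
          apply Real.exp_le_exp.mpr; nlinarith)) (by linarith)
        (ih (t - ℓ) (by linarith)) x ⟨hx.1, by linarith [hx.2]⟩ y ⟨hy.1, by linarith [hy.2]⟩
      have h1 : Real.exp (σ * (t - ℓ)) ≤ Real.exp (σ * t) := by
        apply Real.exp_le_exp.mpr; nlinarith
      have h2 : θ * (D * Real.exp (σ * (t - ℓ))) ≤ θ * (D * Real.exp (σ * t)) := by gcongr
      have h3 : t - ℓ - ((n : ℝ) + 1) * ℓ = t - (((n + 1 : ℕ) : ℝ) + 1) * ℓ := by push_cast; ring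
      rw [h3] at this
      rw [pow_succ]
      calc _ ≤ _ := this
        _ ≤ _ := by rw [← hθ]; linear_combination h2 + Real.exp (σ * t) * hDθ
  have hosc : ∀ t ≤ T, ∀ x ∈ Icc (t - ℓ) t, ∀ y ∈ Icc (t - ℓ) t, U x - U y ≤ D * Real.exp (σ * t) := by
    intro t ht x hx y hy
    have hlim : Tendsto (fun n : ℕ => (2 * C0 * Real.exp (-η * (t - ℓ))) * (θ * Real.exp (η * ℓ)) ^ n
        + D * Real.exp (σ * t)) atTop (nhds ((2 * C0 * Real.exp (-η * (t - ℓ))) * 0 + D * Real.exp (σ * t))) :=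
      ((tendsto_pow_atTop_nhds_zero_of_lt_one (by positivity) hηθ).const_mul _).add_const _
    have h2 := ge_of_tendsto' hlim (fun n => (main n t ht x hx y hy).trans (le_of_eq (by
      have : Real.exp (-η * (t - (n + 1) * ℓ)) = Real.exp (-η * (t - ℓ)) * Real.exp (η * ℓ) ^ n := by
        rw [← Real.exp_nat_mul, ← Real.exp_add]; ring_nf
      rw [this, mul_pow]; ring)))
    linarith
  have hder : ∀ t ≤ T, |U1 t| ≤ (κ * D + C) * Real.exp (σ * t) := by
    intro t ht
    have h1 := abs_le.mp (hU1 t ht)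
    have h2 := hZ t ht (U t - D * Real.exp (σ * t)) (fun s hs => by
      have := hosc t ht t ⟨by linarith, le_rfl⟩ s ⟨by linarith [hs.1], hs.2⟩; linarith)
    have h3 := hZ' t ht (U t + D * Real.exp (σ * t)) (fun s hs => by
      have := hosc t ht s ⟨by linarith [hs.1], hs.2⟩ t ⟨by linarith, le_rfl⟩; linarith)
    rw [abs_le]; constructor <;> linarith
  obtain ⟨L, hL⟩ := nf_lim hU hσ hder
  exact ⟨L, _, hL⟩


structure NFront (g : ℝ → ℝ) (c h : ℝ) (φ φ1 φ2 : ℝ → ℝ) : Prop where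
  d1 : ∀ t, HasDerivAt φ (φ1 t) t
  d2 : ∀ t, HasDerivAt φ1 (φ2 t) t
  eq : ∀ t, φ2 t = c * φ1 t + φ t - g (φ (t - c * h))
  pos : ∀ t, 0 < φ t
  lim0 : Tendsto φ atBot (nhds 0)

def EB (f : ℝ → ℝ) (μ : ℝ) : Prop := ∃ C T, 0 ≤ C ∧ ∀ t ≤ T, |f t| ≤ C * Real.exp (μ * t)

theorem EB.mono {f : ℝ → ℝ} {μ μ' : ℝ} (h : EB f μ) (hm : μ' ≤ μ) : EB f μ' := by
  obtain ⟨C, T, hC, H⟩ := h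
  refine ⟨C, min T 0, hC, fun t ht => (H t (ht.trans (min_le_left _ _))).trans ?_⟩
  apply mul_le_mul_of_nonneg_left _ hC
  apply Real.exp_le_exp.mpr
  have := ht.trans (min_le_right _ _)
  nlinarith

theorem EB.lin {f g : ℝ → ℝ} {μ : ℝ} (hf : EB f μ) (hg : EB g μ) (a b : ℝ) :
    EB (fun t => a * f t + b * g t) μ := by
  obtain ⟨C, T, hC, H⟩ := hf
  obtain ⟨C', T', hC', H'⟩ := hg
  refine ⟨|a| * C + |b| * C', min T T', by positivity, fun t ht => ?_⟩
  have h1 := H t (ht.trans (min_le_left _ _))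
  have h2 := H' t (ht.trans (min_le_right _ _))
  calc |a * f t + b * g t| ≤ |a * f t| + |b * g t| := abs_add_le _ _
    _ = |a| * |f t| + |b| * |g t| := by rw [abs_mul, abs_mul]
    _ ≤ |a| * (C * Real.exp (μ * t)) + |b| * (C' * Real.exp (μ * t)) := by gcongr
    _ = _ := by ring

theorem EB.congr {f g : ℝ → ℝ} {μ : ℝ} (hf : EB f μ) (h : ∀ t, f t = g t) : EB g μ := by
  have : f = g := funext h
  rwa [← this]

theorem nf_exp_tendsto {μ : ℝ} (hμ : 0 < μ) : Tendsto (fun t => Real.exp (μ * t)) atBot (nhds 0) :=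
  Real.tendsto_exp_atBot.comp (tendsto_id.const_mul_atBot hμ)

theorem EB.tendsto {f : ℝ → ℝ} {μ : ℝ} (h : EB f μ) (hm : 0 < μ) : Tendsto f atBot (nhds 0) := by
  obtain ⟨C, T, hC, H⟩ := h
  have h1 : Tendsto (fun t => C * Real.exp (μ * t)) atBot (nhds 0) := by
    simpa using (nf_exp_tendsto hm).const_mul C
  apply squeeze_zero_norm' _ h1
  filter_upwards [eventually_le_atBot T] with t ht using H t ht

theorem EB.isBigO {f : ℝ → ℝ} {μ : ℝ} (h : EB f μ) : f =O[atBot] fun t => Real.exp (μ * t) := by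
  obtain ⟨C, T, hC, H⟩ := h
  apply IsBigO.of_bound C
  filter_upwards [eventually_le_atBot T] with t ht
  rw [Real.norm_eq_abs, Real.norm_eq_abs, abs_of_pos (Real.exp_pos _)]
  exact H t ht

/-! ### characteristic function -/

theorem chi_cvx {b : ℝ} (hb : 0 ≤ b) (c h : ℝ) {x y z : ℝ} (hxy : x < y) (hyz : y < z) :
    (z - x) * chi0 b c h y < (z - y) * chi0 b c h x + (y - x) * chi0 b c h z := by
  have h2 : (z - x) * Real.exp (-(y * c * h)) ≤ (z - y) * Real.exp (-(x * c * h)) + (y - x) * Real.exp (-(z * c * h)) := by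
    have e : ∀ w : ℝ, Real.exp (-(w * c * h)) = Real.exp (-(y * c * h)) * Real.exp (-((w - y) * (c * h))) := by
      intro w; rw [← Real.exp_add]; ring_nf
    rw [e x, e z]
    have i1 := Real.add_one_le_exp (-((x - y) * (c * h)))
    have i2 := Real.add_one_le_exp (-((z - y) * (c * h)))
    have i3 := Real.exp_pos (-(y * c * h))
    have i4 : (z - x) ≤ (z - y) * Real.exp (-((x - y) * (c * h))) + (y - x) * Real.exp (-((z - y) * (c * h))) := by
      nlinarith
    calc _ = Real.exp (-(y * c * h)) * (z - x) := by ring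
      _ ≤ _ := mul_le_mul_of_nonneg_left i4 i3.le
      _ = _ := by ring
  unfold chi0
  have h3 := mul_le_mul_of_nonneg_left h2 hb
  have h4 : 0 < (z - x) * (y - x) * (z - y) :=
    mul_pos (mul_pos (by linarith) (by linarith)) (by linarith)
  nlinarith

theorem chi_pos_right {b c h l2 l1 z : ℝ} (hb : 0 ≤ b) (h12 : l2 < l1) (h2 : chi0 b c h l2 = 0)
    (h1 : chi0 b c h l1 = 0) (hz : l1 < z) : 0 < chi0 b c h z := by
  have := chi_cvx hb c h h12 hz
  rw [h1, h2] at this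
  have : 0 < (l1 - l2) * chi0 b c h z := by linarith
  by_contra hh
  nlinarith

theorem chi_pos_left {b c h l2 l1 z : ℝ} (hb : 0 ≤ b) (h12 : l2 < l1) (h2 : chi0 b c h l2 = 0)
    (h1 : chi0 b c h l1 = 0) (hz : z < l2) : 0 < chi0 b c h z := by
  have := chi_cvx hb c h hz h12
  rw [h1, h2] at this
  by_contra hh
  nlinarith

theorem chi_cont (b c h : ℝ) : Continuous (chi0 b c h) := by
  unfold chi0; fun_prop

theorem chi_big {b c h z : ℝ} (hb : 0 < b) (hc : 0 ≤ c) (hz : c + 1 ≤ z) : 0 < chi0 b c h z := by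
  unfold chi0
  have := mul_pos hb (Real.exp_pos (-(z * c * h)))
  nlinarith

theorem chi_mono_c {b c c' h z : ℝ} (hb : 0 ≤ b) (hh : 0 ≤ h) (hz : 0 < z) (hc : c < c') :
    chi0 b c' h z < chi0 b c h z := by
  unfold chi0
  have : Real.exp (-(z * c' * h)) ≤ Real.exp (-(z * c * h)) := by
    apply Real.exp_le_exp.mpr
    have : z * c * h ≤ z * c' * h := by gcongr
    linarith
  have := mul_le_mul_of_nonneg_left this hb
  nlinarith

theorem chi_root1 {b c h z : ℝ} (hb : 0 < b) (hc : 0 ≤ c) (hz : chi0 b c h z < 0) :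
    ∃ l1, z < l1 ∧ chi0 b c h l1 = 0 := by
  have hzc : z < c + 1 := by
    by_contra hh
    exact absurd (chi_big (h := h) hb hc (not_lt.mp hh)) (by linarith)
  have := intermediate_value_Icc hzc.le (chi_cont b c h).continuousOn
  obtain ⟨l, hl, hl0⟩ := this ⟨hz.le, (chi_big hb hc le_rfl).le⟩
  refine ⟨l, lt_of_le_of_ne hl.1 ?_, hl0⟩
  rintro rfl; linarith

theorem chi_root2 {b c h z : ℝ} (hb : 1 < b) (hz0 : 0 < z) (hz : chi0 b c h z < 0) :
    ∃ l2, 0 < l2 ∧ l2 < z ∧ chi0 b c h l2 = 0 := by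
  have h0 : 0 < chi0 b c h 0 := by unfold chi0; simp; linarith
  have := intermediate_value_Icc' hz0.le (chi_cont b c h).continuousOn
  obtain ⟨l, hl, hl0⟩ := this ⟨hz.le, h0.le⟩
  refine ⟨l, lt_of_le_of_ne hl.1 ?_, lt_of_le_of_ne hl.2 ?_, hl0⟩
  · rintro rfl; linarith
  · rintro rfl; linarith

/-- `l1 + l2 - c = b e^{-l1 τ} K` -/
theorem chi_kappa {b c h l2 l1 : ℝ} (h12 : l2 < l1) (h2 : chi0 b c h l2 = 0)
    (h1 : chi0 b c h l1 = 0) :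
    l1 + l2 - c = b * Real.exp (-(l1 * (c * h))) * ((Real.exp ((l1 - l2) * (c * h)) - 1) / (l1 - l2)) := by
  have hne : l1 - l2 ≠ 0 := by linarith
  have e : Real.exp (-(l2 * c * h)) = Real.exp (-(l1 * (c * h))) * Real.exp ((l1 - l2) * (c * h)) := by
    rw [← Real.exp_add]; ring_nf
  have e1 : Real.exp (-(l1 * c * h)) = Real.exp (-(l1 * (c * h))) := by ring_nf
  unfold chi0 at h1 h2
  rw [e] at h2
  rw [e1] at h1
  generalize Real.exp (-(l1 * (c * h))) = a at *
  generalize Real.exp ((l1 - l2) * (c * h)) = e' at *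
  rw [mul_div_assoc', eq_div_iff hne]
  linear_combination h1 - h2

/-! ### basic front estimates -/

theorem nf_nu {g : ℝ → ℝ} {c h ν : ℝ} {φ φ1 φ2 : ℝ → ℝ} (F : NFront g c h φ φ1 φ2)
    (hg : ∀ x, 0 ≤ x → 0 ≤ g x) (hν0 : 0 < ν) (hν : ν ^ 2 = c * ν + 1) : ∀ t, φ1 t ≤ ν * φ t := by
  intro t0
  by_contra hh
  push Not at hh
  set μ := c - ν with hμ
  have hμν : μ * ν = -1 := by rw [hμ]; linarith
  have hμ0 : μ < 0 := by
    by_contra h0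
    push Not at h0
    nlinarith
  have hd : ∀ s, HasDerivAt (fun s => Real.exp (-μ * s) * (φ1 s - ν * φ s))
      (Real.exp (-μ * s) * (- g (φ (s - c * h)))) s := fun s => by
    refine ((nf_exp_deriv (-μ) s).mul ((F.d2 s).sub ((F.d1 s).const_mul ν))).congr_deriv ?_
    simp only [Pi.sub_apply]
    rw [F.eq s]
    linear_combination Real.exp (-μ * s) * φ s * hμν - Real.exp (-μ * s) * φ1 s * hμ
  have ha := nf_anti (convex_Iic t0) hd (fun s _ => by
    have := hg _ (F.pos (s - c * h)).le
    have := Real.exp_pos (-μ * s)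
    nlinarith)
  have hlow : ∀ t ≤ t0, φ1 t0 - ν * φ t0 ≤ φ1 t := by
    intro t ht
    have h1 := ha (show t ∈ Iic t0 from ht) self_mem_Iic ht
    simp only at h1
    have h2 : Real.exp (-μ * t) ≤ Real.exp (-μ * t0) := Real.exp_le_exp.mpr (by nlinarith)
    have h3 := Real.exp_pos (-μ * t)
    have h4 : Real.exp (-μ * t) * (φ1 t0 - ν * φ t0) ≤ Real.exp (-μ * t) * (φ1 t - ν * φ t) :=
      (mul_le_mul_of_nonneg_right h2 (by linarith)).trans h1
    have h5 := le_of_mul_le_mul_left h4 h3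
    have := F.pos t
    nlinarith
  set d := φ1 t0 - ν * φ t0 with hd'
  have hd0 : 0 < d := by linarith
  have hm := nf_mono (F := fun s => φ s - d * s) (F' := fun s => φ1 s - d) (convex_Iic t0) (fun s => by
    refine ((F.d1 s).sub ((hasDerivAt_id s).const_mul d)).congr_deriv ?_
    ring) (fun s hs => by have := hlow s hs; linarith)
  have hpos := F.pos t0
  have hx : t0 - φ t0 / d ≤ t0 := by have : 0 < φ t0 / d := by positivity
                                     linarith
  have h1 := hm (show t0 - φ t0 / d ∈ Iic t0 from hx) self_mem_Iic hx
  simp only at h1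
  have h2 := F.pos (t0 - φ t0 / d)
  have h3 : d * (t0 - φ t0 / d) = d * t0 - φ t0 := by field_simp
  linarith

theorem nf_sup {g : ℝ → ℝ} {c h b T : ℝ} {φ φ1 φ2 : ℝ → ℝ} (F : NFront g c h φ φ1 φ2)
    (hg : ∀ x, 0 ≤ x → 0 ≤ g x) (hb : 0 ≤ b) (hτ : 0 ≤ c * h)
    (hG : ∀ t ≤ T, b * φ (t - c * h) ≤ g (φ (t - c * h))) :
    ∃ Q > 0, chi0 b c h Q ≤ 0 ∧ ∀ t ≤ T, φ1 t ≤ Q * φ t := by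
  set ν := (c + Real.sqrt (c ^ 2 + 4)) / 2 with hνd
  have hsq : Real.sqrt (c ^ 2 + 4) ^ 2 = c ^ 2 + 4 := Real.sq_sqrt (by positivity)
  have hs0 : 0 ≤ Real.sqrt (c ^ 2 + 4) := Real.sqrt_nonneg _
  have hν0 : 0 < ν := by
    have : -c < Real.sqrt (c ^ 2 + 4) := Real.lt_sqrt_of_sq_lt (by nlinarith)
    rw [hνd]; linarith
  have hν : ν ^ 2 = c * ν + 1 := by rw [hνd]; nlinarith
  have hnu := nf_nu F hg hν0 hν
  set q : ℝ → ℝ := fun t => φ1 t / φ t with hq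
  have hqb : BddAbove (q '' Iic T) := ⟨ν, by
    rintro _ ⟨t, _, rfl⟩
    simp only [hq]
    rw [div_le_iff₀ (F.pos t)]; exact hnu t⟩
  set Q := sSup (q '' Iic T) with hQ
  have hqQ : ∀ t ≤ T, q t ≤ Q := fun t ht => le_csSup hqb ⟨t, ht, rfl⟩
  have hφQ : ∀ t ≤ T, φ1 t ≤ Q * φ t := fun t ht => by
    have := hqQ t ht
    simp only [hq] at this
    rwa [div_le_iff₀ (F.pos t)] at this
  have hQ0 : 0 < Q := by
    by_contra h0
    push Not at h0
    have ha := nf_anti (convex_Iic T) F.d1 (fun s hs => by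
      have := hφQ s hs
      have := F.pos s
      nlinarith)
    have : φ T ≤ 0 := ge_of_tendsto F.lim0 (by
      filter_upwards [eventually_le_atBot T] with t ht
      exact ha (show t ∈ Iic T from ht) self_mem_Iic ht)
    linarith [F.pos T]
  refine ⟨Q, hQ0, ?_, hφQ⟩
  by_contra hP
  push Not at hP
  -- delay comparison
  have hdel : ∀ t ≤ T, Real.exp (-(Q * c * h)) * φ t ≤ φ (t - c * h) := by
    intro t ht
    have hd : ∀ s, HasDerivAt (fun s => Real.exp (-Q * s) * φ s) (Real.exp (-Q * s) * (φ1 s - Q * φ s)) s := fun s => by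
      refine ((nf_exp_deriv (-Q) s).mul (F.d1 s)).congr_deriv ?_
      ring
    have ha := nf_anti (convex_Iic T) hd (fun s hs => by
      have := hφQ s hs
      have := Real.exp_pos (-Q * s)
      nlinarith)
    have h1 := ha (show t - c * h ∈ Iic T from by simp only [mem_Iic]; linarith) (show t ∈ Iic T from ht) (by linarith)
    simp only at h1
    have h2 := mul_le_mul_of_nonneg_left h1 (Real.exp_pos (Q * (t - c * h))).le
    rw [← mul_assoc, ← mul_assoc, ← Real.exp_add, ← Real.exp_add] at h2
    have e1 : Q * (t - c * h) + -Q * t = -(Q * c * h) := by ring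
    have e2 : Q * (t - c * h) + -Q * (t - c * h) = 0 := by ring
    rw [e1, e2, Real.exp_zero, one_mul] at h2
    exact h2
  set P : ℝ → ℝ := fun x => x ^ 2 - c * x - 1 + b * Real.exp (-(Q * c * h)) with hPd
  have hPc : Continuous P := by rw [hPd]; fun_prop
  have hPQ : 0 < P Q := hP
  have hq1 : ∀ t, HasDerivAt q ((φ2 t * φ t - φ1 t * φ1 t) / φ t ^ 2) t := fun t =>
    (F.d2 t).div (F.d1 t) (F.pos t).ne'
  have hq1P : ∀ t ≤ T, (φ2 t * φ t - φ1 t * φ1 t) / φ t ^ 2 ≤ - P (q t) := by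
    intro t ht
    have hp := F.pos t
    rw [div_le_iff₀ (by positivity)]
    have e : P (q t) * φ t ^ 2 = φ1 t ^ 2 - c * φ1 t * φ t - φ t ^ 2 + b * Real.exp (-(Q * c * h)) * φ t ^ 2 := by
      simp only [hPd, hq]; field_simp
    have h1 := hdel t ht
    have h2 := hG t ht
    have h3 := F.eq t
    have h4 : b * (Real.exp (-(Q * c * h)) * φ t) ≤ g (φ (t - c * h)) := (mul_le_mul_of_nonneg_left h1 hb).trans h2
    rw [neg_mul, e, h3]
    nlinarith
  obtain ⟨ε, hε, hball⟩ := Metric.continuous_iff.mp hPc Q (P Q / 2) (by linarith)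
  have hnear : ∀ x, Q - ε < x → x ≤ Q → P Q / 2 < P x := by
    intro x hx1 hx2
    have := hball x (by rw [Real.dist_eq, abs_lt]; constructor <;> linarith)
    rw [Real.dist_eq, abs_lt] at this
    linarith
  obtain ⟨_, ⟨t0, ht0, rfl⟩, hqt0⟩ := exists_lt_of_lt_csSup (Set.nonempty_Iic.image q) (show Q - ε < Q by linarith)
  have ht0' : t0 ≤ T := ht0
  have hback : ∀ t ≤ t0, q t0 ≤ q t := by
    intro t ht
    have hc : ContinuousOn q (Icc t t0) := fun s _ => (hq1 s).continuousAt.continuousWithinAt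
    obtain ⟨x, hx, hmax⟩ := isCompact_Icc.exists_isMaxOn (nonempty_Icc.mpr ht) hc
    have hmax' : ∀ s ∈ Icc t t0, q s ≤ q x := hmax
    have h1 := hmax' t0 (right_mem_Icc.mpr ht)
    have hxT : x ≤ T := hx.2.trans ht0'
    rcases eq_or_lt_of_le hx.1 with h | h
    · rw [h]; exact h1
    · exfalso
      have h2 := hnear (q x) (by linarith) (hqQ x hxT)
      have h3 := hq1P x hxT
      obtain ⟨s, hs, hs2⟩ := nf_left_lt (hq1 x).neg (by linarith) h
      have := hmax' s ⟨hs.1.le, hs.2.le.trans hx.2⟩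
      simp only [Pi.neg_apply] at hs2
      linarith
  set d := P Q / 2 with hd
  have hd0 : 0 < d := by linarith
  have ha := nf_anti (F := fun s => q s + d * s) (convex_Iic t0) (fun s => (hq1 s).add ((hasDerivAt_id s).const_mul d))
    (fun s hs => by
      have hs' : s ≤ t0 := hs
      have h1 := hq1P s (hs'.trans ht0')
      have h2 := hnear (q s) (by linarith [hback s hs']) (hqQ s (hs'.trans ht0'))
      linarith)
  have hx : t0 - (ε + 1) / d ≤ t0 := by have : 0 < (ε + 1) / d := by positivity
                                        linarith
  have h1 := ha (show t0 - (ε + 1) / d ∈ Iic t0 from hx) self_mem_Iic hx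
  simp only at h1
  have h2 := hqQ _ (hx.trans ht0')
  have h3 : d * (t0 - (ε + 1) / d) = d * t0 - (ε + 1) := by field_simp
  linarith

theorem nf_gb {g : ℝ → ℝ} {b b' : ℝ} (hg : HasDerivAt g b 0) (g0 : g 0 = 0) (hb : b' < b) :
    ∃ δ > 0, ∀ u, 0 ≤ u → u ≤ δ → b' * u ≤ g u := by
  have h1 := (hasDerivAt_iff_tendsto_slope.mp hg).mono_left
    (nhdsWithin_mono 0 (show Ioi (0:ℝ) ⊆ {0}ᶜ from fun x hx => ne_of_gt hx))
  have h2 := h1.eventually (lt_mem_nhds hb)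
  obtain ⟨δ, hδ, H⟩ := mem_nhdsGT_iff_exists_Ioc_subset.mp h2
  refine ⟨δ, hδ, fun u hu0 hu => ?_⟩
  rcases eq_or_lt_of_le hu0 with h | h
  · rw [← h, g0]; simp
  · have h3 : b' < slope g 0 u := H ⟨h, hu⟩
    rw [slope_def_field, g0, sub_zero, sub_zero, lt_div_iff₀ h] at h3
    exact h3.le

theorem nf_twoq {g : ℝ → ℝ} {c h b b' : ℝ} {φ φ1 φ2 : ℝ → ℝ} (F : NFront g c h φ φ1 φ2)
    (hg : ∀ x, 0 ≤ x → 0 ≤ g x) (hgb : HasDerivAt g b 0) (g0 : g 0 = 0)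
    (hb : 0 ≤ b') (hbb : b' < b) (hτ : 0 ≤ c * h) :
    ∃ T Q, 0 < Q ∧ chi0 b' c h Q ≤ 0 ∧ (∀ t ≤ T, φ1 t ≤ Q * φ t) ∧
      ∀ t ≤ T, b' * φ (t - c * h) ≤ g (φ (t - c * h)) := by
  obtain ⟨δ, hδ, H⟩ := nf_gb hgb g0 hbb
  obtain ⟨T, hT⟩ := eventually_atBot.mp (F.lim0.eventually (gt_mem_nhds hδ))
  have hG : ∀ t ≤ T, b' * φ (t - c * h) ≤ g (φ (t - c * h)) := fun t ht =>
    H _ (F.pos _).le (hT _ (by linarith)).le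
  obtain ⟨Q, h1, h2, h3⟩ := nf_sup F hg hb hτ hG
  exact ⟨T, Q, h1, h2, h3, hG⟩

theorem nf_chi_nonpos {g : ℝ → ℝ} {c h b : ℝ} {φ φ1 φ2 : ℝ → ℝ} (F : NFront g c h φ φ1 φ2)
    (hg : ∀ x, 0 ≤ x → 0 ≤ g x) (hgb : HasDerivAt g b 0) (g0 : g 0 = 0)
    (hb : 1 < b) (hc : 0 ≤ c) (hh : 0 ≤ h) : ∃ z > 0, chi0 b c h z ≤ 0 := by
  obtain ⟨z, hz, hmin⟩ := isCompact_Icc.exists_isMinOn (nonempty_Icc.mpr (show (0:ℝ) ≤ c + 1 by linarith))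
    (chi_cont b c h).continuousOn
  have hmin' : ∀ s ∈ Icc 0 (c + 1), chi0 b c h z ≤ chi0 b c h s := hmin
  have hle : chi0 b c h z ≤ 0 := by
    by_contra hp
    push Not at hp
    set b' := max 1 (b - chi0 b c h z / 2) with hb'
    have hb'1 : 1 ≤ b' := le_max_left _ _
    have hb'2 : b - chi0 b c h z / 2 ≤ b' := le_max_right _ _
    have hb'3 : b' < b := max_lt hb (by linarith)
    obtain ⟨T, Q, hQ, hQ2, -, -⟩ := nf_twoq F hg hgb g0 (by linarith) hb'3 (mul_nonneg hc hh)
    have hQ3 : Q ≤ c + 1 := by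
      by_contra hcon
      exact absurd (chi_big (h := h) (show 0 < b' by linarith) hc (not_le.mp hcon).le) (by linarith)
    have h1 := hmin' Q ⟨hQ.le, hQ3⟩
    have h2 : Real.exp (-(Q * c * h)) ≤ 1 := by
      apply Real.exp_le_one_iff.mpr
      have : 0 ≤ Q * c * h := by positivity
      linarith
    have h3 : chi0 b c h Q = chi0 b' c h Q + (b - b') * Real.exp (-(Q * c * h)) := by unfold chi0; ring
    nlinarith
  refine ⟨z, lt_of_le_of_ne hz.1 ?_, hle⟩
  rintro rfl
  unfold chi0 at hle
  simp at hle
  linarith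


theorem EB.exp (a μ : ℝ) : EB (fun t => a * Real.exp (μ * t)) μ :=
  ⟨|a|, 0, abs_nonneg _, fun t _ => by rw [abs_mul, abs_of_pos (Real.exp_pos _)]⟩

theorem EB.exp_mul {f : ℝ → ℝ} {μ : ℝ} (hf : EB f μ) (a : ℝ) :
    EB (fun t => Real.exp (a * t) * f t) (a + μ) := by
  obtain ⟨C, T, hC, H⟩ := hf
  refine ⟨C, T, hC, fun t ht => ?_⟩
  rw [abs_mul, abs_of_pos (Real.exp_pos _), add_mul, Real.exp_add]
  have := mul_le_mul_of_nonneg_left (H t ht) (Real.exp_pos (a * t)).le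
  linarith

theorem EB.shift {f : ℝ → ℝ} {μ : ℝ} (hf : EB f μ) (s : ℝ) : EB (fun t => f (t + s)) μ := by
  obtain ⟨C, T, hC, H⟩ := hf
  refine ⟨C * Real.exp (μ * s), T - s, by positivity, fun t ht => ?_⟩
  have := H (t + s) (by linarith)
  rwa [mul_add, Real.exp_add, mul_comm (Real.exp (μ * t)), ← mul_assoc] at this

theorem nf_back {f f1 : ℝ → ℝ} {l μ : ℝ} (hf : ∀ t, HasDerivAt f (f1 t) t) (hμ : μ < l)
    (hE : EB (fun t => f1 t - l * f t) μ) : EB f μ := by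
  obtain ⟨C, T, hC, H⟩ := hE
  have hlm : 0 < l - μ := by linarith
  refine ⟨|f T| * Real.exp (-(μ * T)) + C / (l - μ), T, by positivity, fun t ht => ?_⟩
  have h1 := nf_win_lower (m := -C) (μ := μ) (l := l) hf hμ.ne' ht (fun s hs => by
    have := (abs_le.mp (H s hs.2)).1
    simp only at this
    linarith)
  have h2 := nf_win_upper (m := C) (μ := μ) (l := l) hf hμ.ne' ht (fun s hs => by
    have := (abs_le.mp (H s hs.2)).2
    exact this)
  set w := (Real.exp ((l - μ) * (T - t)) - 1) / (l - μ) with hw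
  have hw0 : 0 ≤ w := by
    apply div_nonneg _ hlm.le
    have := Real.one_le_exp (show 0 ≤ (l - μ) * (T - t) from mul_nonneg hlm.le (by linarith))
    linarith
  have hw1 : w ≤ Real.exp ((l - μ) * (T - t)) / (l - μ) := by
    rw [hw]; gcongr; linarith
  have h3 : |Real.exp (l * (T - t)) * f t| ≤ |f T| + C * Real.exp (μ * T) * (Real.exp ((l - μ) * (T - t)) / (l - μ)) := by
    have := mul_le_mul_of_nonneg_left hw1 (show 0 ≤ C * Real.exp (μ * T) by positivity)
    have h5 := neg_abs_le (f T)
    have h6 := le_abs_self (f T)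
    rw [abs_le]; constructor <;> linarith
  rw [abs_mul, abs_of_pos (Real.exp_pos _)] at h3
  have h4 := mul_le_mul_of_nonneg_left h3 (Real.exp_pos (-(l * (T - t)))).le
  rw [← mul_assoc, ← Real.exp_add, neg_add_cancel, Real.exp_zero, one_mul] at h4
  refine h4.trans ?_
  have e1 : Real.exp (-(l * (T - t))) * (C * Real.exp (μ * T) * (Real.exp ((l - μ) * (T - t)) / (l - μ)))
      = C / (l - μ) * Real.exp (μ * t) := by
    have : Real.exp (μ * t) = Real.exp (-(l * (T - t))) * Real.exp (μ * T) * Real.exp ((l - μ) * (T - t)) := by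
      rw [← Real.exp_add, ← Real.exp_add]; ring_nf
    rw [this]; ring
  have e2 : Real.exp (-(l * (T - t))) ≤ Real.exp (-(μ * T)) * Real.exp (μ * t) := by
    rw [← Real.exp_add]
    apply Real.exp_le_exp.mpr
    nlinarith
  rw [mul_add, e1, add_mul]
  have := mul_le_mul_of_nonneg_left e2 (abs_nonneg (f T))
  linarith

theorem nf_expform {b c h l : ℝ} (h1 : chi0 b c h l = 0) :
    l ^ 2 - c * l - 1 = - (b * Real.exp (-(l * (c * h)))) := by
  have : Real.exp (-(l * c * h)) = Real.exp (-(l * (c * h))) := by ring_nf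
  unfold chi0 at h1
  rw [this] at h1
  linarith

theorem nf_kappa_nonneg {b c h l2 l1 : ℝ} (hb : 0 ≤ b) (hτ : 0 ≤ c * h) (h12 : l2 < l1)
    (h2 : chi0 b c h l2 = 0) (h1 : chi0 b c h l1 = 0) : 0 ≤ l1 + l2 - c := by
  rw [chi_kappa h12 h2 h1]
  have : 0 < l1 - l2 := by linarith
  have := Real.one_le_exp (show 0 ≤ (l1 - l2) * (c * h) from mul_nonneg this.le hτ)
  have : 0 ≤ (Real.exp ((l1 - l2) * (c * h)) - 1) / (l1 - l2) := div_nonneg (by linarith) (by linarith)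
  positivity

/-- Lower bound of the delayed term. -/
theorem nf_Zlow {b c h l2 l1 m t : ℝ} {f f1 : ℝ → ℝ} (hb : 0 ≤ b) (hτ : 0 ≤ c * h) (h12 : l2 < l1)
    (h2 : chi0 b c h l2 = 0) (h1 : chi0 b c h l1 = 0) (hf : ∀ t, HasDerivAt f (f1 t) t)
    (H : ∀ s ∈ Icc (t - c * h) t, m ≤ Real.exp (-l2 * s) * (f1 s - l1 * f s)) :
    (l1 + l2 - c) * m ≤ Real.exp (-l2 * t) * (b * Real.exp (-(l1 * (c * h))) * f t - b * f (t - c * h)) := by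
  have h3 := nf_win_lower (m := m) (μ := l2) (l := l1) hf h12.ne' (show t - c * h ≤ t by linarith) (fun s hs => by
    have := mul_le_mul_of_nonneg_left (H s hs) (Real.exp_pos (l2 * s)).le
    rw [← mul_assoc, ← Real.exp_add] at this
    have e : l2 * s + -l2 * s = 0 := by ring
    rw [e, Real.exp_zero, one_mul] at this
    linarith)
  rw [chi_kappa h12 h2 h1]
  have e0 : t - (t - c * h) = c * h := by ring
  rw [e0] at h3
  set K := (Real.exp ((l1 - l2) * (c * h)) - 1) / (l1 - l2)
  have h4 := mul_le_mul_of_nonneg_left h3 (show 0 ≤ Real.exp (-l2 * t) * (b * Real.exp (-(l1 * (c * h)))) by positivity)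
  have e1 : Real.exp (-l2 * t) * Real.exp (l2 * t) = 1 := by rw [← Real.exp_add]; simp
  have e2 : Real.exp (-(l1 * (c * h))) * Real.exp (l1 * (c * h)) = 1 := by rw [← Real.exp_add]; simp
  have e3 : Real.exp (-l2 * t) * (b * Real.exp (-(l1 * (c * h)))) * (m * Real.exp (l2 * t) * K)
     = b * Real.exp (-(l1 * (c * h))) * K * m := by
     linear_combination b * Real.exp (-(l1 * (c * h))) * K * m * e1
  have e4 : Real.exp (-l2 * t) * (b * Real.exp (-(l1 * (c * h)))) * (f t - Real.exp (l1 * (c * h)) * f (t - c * h))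
     = Real.exp (-l2 * t) * (b * Real.exp (-(l1 * (c * h))) * f t - b * f (t - c * h)) := by
     linear_combination -(Real.exp (-l2 * t) * b * f (t - c * h)) * e2
  rw [e3, e4] at h4
  exact h4

theorem nf_apriori {g : ℝ → ℝ} {c h b b' l2 l1 : ℝ} {φ φ1 φ2 : ℝ → ℝ} (F : NFront g c h φ φ1 φ2)
    (hg : ∀ x, 0 ≤ x → 0 ≤ g x) (hgb : HasDerivAt g b 0) (g0 : g 0 = 0)
    (hb : 0 ≤ b') (hbb : b' < b) (hτ : 0 ≤ c * h) (h12 : l2 < l1)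
    (h2 : chi0 b' c h l2 = 0) (h1 : chi0 b' c h l1 = 0) : EB φ l2 ∧ EB φ1 l2 := by
  obtain ⟨T, Q, hQ, hQ2, hφQ, hG⟩ := nf_twoq F hg hgb g0 hb hbb hτ
  have hQl : Q ≤ l1 := by
    by_contra hcon
    exact absurd (chi_pos_right hb h12 h2 h1 (not_le.mp hcon)) (by linarith)
  have hκ := nf_kappa_nonneg hb hτ h12 h2 h1
  set κ := l1 + l2 - c with hκd
  set U : ℝ → ℝ := fun t => Real.exp (-l2 * t) * (-φ1 t - l1 * (-φ t)) with hUd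
  set U1 : ℝ → ℝ := fun t => -l2 * Real.exp (-l2 * t) * (-φ1 t - l1 * (-φ t)) + Real.exp (-l2 * t) * (-φ2 t - l1 * (-φ1 t)) with hU1d
  set Z : ℝ → ℝ := fun t => Real.exp (-l2 * t) * (b' * Real.exp (-(l1 * (c * h))) * (-φ t) - b' * (-φ (t - c * h))) with hZd
  have hU : ∀ t, HasDerivAt U (U1 t) t := fun t =>
    (nf_exp_deriv (-l2) t).mul ((F.d2 t).neg.sub ((F.d1 t).neg.const_mul l1))
  have hU0 : ∀ t ≤ T, 0 ≤ U t := fun t ht => by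
    have h3 := hφQ t ht
    have h4 := F.pos t
    have : 0 ≤ -φ1 t - l1 * (-φ t) := by nlinarith
    exact mul_nonneg (Real.exp_pos _).le this
  have hZ : ∀ t ≤ T, ∀ m', (∀ s ∈ Icc (t - c * h) t, m' ≤ U s) → κ * m' ≤ Z t := fun t _ m' H =>
    nf_Zlow (f := fun t => -φ t) (f1 := fun t => -φ1 t) hb hτ h12 h2 h1 (fun t => (F.d1 t).neg) H
  have hUZ : ∀ t ≤ T, -κ * U t + Z t ≤ U1 t := fun t ht => by
    have h3 := hG t ht
    have h4 := F.eq t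
    have h5 := nf_expform h1
    have h6 := Real.exp_pos (-l2 * t)
    have h7 : U1 t - (-κ * U t + Z t) = Real.exp (-l2 * t) * (g (φ (t - c * h)) - b' * φ (t - c * h)) := by
      simp only [hU1d, hUd, hZd, h4, hκd]
      linear_combination Real.exp (-l2 * t) * φ t * h5
    have h8 := mul_nonneg h6.le (sub_nonneg.mpr h3)
    linarith
  have hUb : ∀ t ≤ T, U (t - c * h) ≤ Real.exp (κ * (c * h)) * U T := by
    intro t ht
    have hwin : ∀ s ∈ Icc (t - c * h) t, Real.exp (-κ * (c * h)) * U (t - c * h) ≤ U s := by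
      intro s hs
      have h3 := nf_decay (m := 0) (E := 0) hU hκ le_rfl hs.1 (fun r hr => by
        have hr' : r ≤ T := hr.2.trans (hs.2.trans ht)
        have h4 := hZ r hr' 0 (fun q hq => hU0 q (hq.2.trans hr'))
        have h5 := hUZ r hr'
        linarith)
      have h4 : Real.exp (-κ * (c * h)) ≤ Real.exp (-κ * (s - (t - c * h))) := by
        apply Real.exp_le_exp.mpr
        have := hs.2
        nlinarith
      have h5 := mul_le_mul_of_nonneg_right h4 (hU0 (t - c * h) (by linarith))
      linarith
    have h3 := nf_inv (E := 0) (ℓ := c * h) (T := T) hU le_rfl le_rfl hZ (fun s _ hs => by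
      have := hUZ s hs; linarith) hτ hwin T ht le_rfl
    have h4 := mul_le_mul_of_nonneg_left h3 (Real.exp_pos (κ * (c * h))).le
    have e1 : Real.exp (κ * (c * h)) * Real.exp (-κ * (c * h)) = 1 := by rw [← Real.exp_add]; simp
    have e2 : Real.exp (κ * (c * h)) * (Real.exp (-κ * (c * h)) * U (t - c * h) - 0 * (T - t)) = U (t - c * h) := by
      linear_combination U (t - c * h) * e1
    rw [e2] at h4
    exact h4
  have hv : EB (fun t => φ1 t - l1 * φ t) l2 := by
    refine ⟨Real.exp (κ * (c * h)) * U T, T - c * h, mul_nonneg (Real.exp_pos _).le (hU0 T le_rfl), fun t ht => ?_⟩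
    have h3 := hUb (t + c * h) (by linarith)
    rw [add_sub_cancel_right] at h3
    have h4 := hU0 t (by linarith)
    have e1 : Real.exp (l2 * t) * Real.exp (-l2 * t) = 1 := by rw [← Real.exp_add]; simp
    have e2 : φ1 t - l1 * φ t = -(Real.exp (l2 * t) * U t) := by
      simp only [hUd]
      linear_combination -(φ1 t - l1 * φ t) * e1
    beta_reduce
    rw [e2, abs_neg, abs_of_nonneg (mul_nonneg (Real.exp_pos _).le h4), mul_comm]
    exact mul_le_mul_of_nonneg_right h3 (Real.exp_pos _).le
  have hφ := nf_back F.d1 h12 hv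
  exact ⟨hφ, (hv.lin hφ 1 l1).congr (fun t => by ring)⟩

theorem nf_holder {g : ℝ → ℝ} {b A δ γ μ τ : ℝ} {φ : ℝ → ℝ} (hA : 0 ≤ A) (hγ : 0 < γ) (hδ : 0 < δ)
    (hH : ∀ u ∈ Icc 0 δ, |b * u - g u| ≤ A * u ^ γ * u) (hpos : ∀ t, 0 < φ t) (hμ : 0 < μ)
    (hφ : EB φ μ) : EB (fun t => b * φ (t - τ) - g (φ (t - τ))) ((1 + γ) * μ) := by
  have hl := (hφ.tendsto hμ).eventually (gt_mem_nhds hδ)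
  obtain ⟨T0, hT0⟩ := eventually_atBot.mp hl
  have key : EB (fun t => b * φ t - g (φ t)) ((1 + γ) * μ) := by
    obtain ⟨C, T, hC, H⟩ := hφ
    refine ⟨A * C ^ γ * C, min T T0, by positivity, fun t ht => ?_⟩
    have h1 := H t (ht.trans (min_le_left _ _))
    have h2 := hT0 t (ht.trans (min_le_right _ _))
    rw [abs_of_pos (hpos t)] at h1
    have h3 : φ t ^ γ ≤ C ^ γ * Real.exp (γ * (μ * t)) := by
      have := Real.rpow_le_rpow (hpos t).le h1 hγ.le
      rw [Real.mul_rpow hC (Real.exp_pos _).le, ← Real.exp_mul, mul_comm (μ * t)] at this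
      exact this
    have h4 : Real.exp ((1 + γ) * μ * t) = Real.exp (γ * (μ * t)) * Real.exp (μ * t) := by
      rw [← Real.exp_add]; ring_nf
    calc |b * φ t - g (φ t)| ≤ A * φ t ^ γ * φ t := hH _ ⟨(hpos t).le, h2.le⟩
      _ ≤ A * (C ^ γ * Real.exp (γ * (μ * t))) * (C * Real.exp (μ * t)) := by
        have := (hpos t).le
        gcongr
      _ = _ := by rw [h4]; ring
  exact key.shift (-τ)

theorem nf_asym {g : ℝ → ℝ} {c h b l2 l1 σ η : ℝ} {φ φ1 φ2 : ℝ → ℝ} (F : NFront g c h φ φ1 φ2)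
    (hb : 0 ≤ b) (hτ : 0 ≤ c * h) (h12 : l2 < l1) (hσ : 0 < σ)
    (h2 : chi0 b c h l2 = 0) (h1 : chi0 b c h l1 = 0)
    (hR : EB (fun t => b * φ (t - c * h) - g (φ (t - c * h))) (l2 + σ))
    (hv : EB (fun t => φ1 t - l1 * φ t) (l2 - η)) (hη : 0 ≤ η)
    (hηθ : (1 - Real.exp (-(l1 + l2 - c) * (c * h)) / 2) * Real.exp (η * (c * h)) < 1) :
    ∃ V, EB (fun t => φ1 t - l1 * φ t - V * Real.exp (l2 * t)) (l2 + σ) := by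
  have hκ := nf_kappa_nonneg hb hτ h12 h2 h1
  obtain ⟨C, T1, hC, HR⟩ := hR.exp_mul (-l2)
  obtain ⟨C0, T2, hC0, Hv⟩ := hv.exp_mul (-l2)
  set κ := l1 + l2 - c with hκd
  set U : ℝ → ℝ := fun t => Real.exp (-l2 * t) * (φ1 t - l1 * φ t) with hUd
  set U1 : ℝ → ℝ := fun t => -l2 * Real.exp (-l2 * t) * (φ1 t - l1 * φ t) + Real.exp (-l2 * t) * (φ2 t - l1 * φ1 t) with hU1d
  set Z : ℝ → ℝ := fun t => Real.exp (-l2 * t) * (b * Real.exp (-(l1 * (c * h))) * (φ t) - b * (φ (t - c * h))) with hZd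
  have hU : ∀ t, HasDerivAt U (U1 t) t := fun t =>
    (nf_exp_deriv (-l2) t).mul ((F.d2 t).sub ((F.d1 t).const_mul l1))
  have hZ : ∀ t ≤ min T1 T2, ∀ m', (∀ s ∈ Icc (t - c * h) t, m' ≤ U s) → κ * m' ≤ Z t := fun t _ m' H =>
    nf_Zlow hb hτ h12 h2 h1 F.d1 H
  have hZ' : ∀ t ≤ min T1 T2, ∀ m', (∀ s ∈ Icc (t - c * h) t, U s ≤ m') → Z t ≤ κ * m' := fun t _ m' H => by
    have := nf_Zlow (m := -m') (t := t) (f := fun t => -φ t) (f1 := fun t => -φ1 t) hb hτ h12 h2 h1 (fun t => (F.d1 t).neg)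
      (fun s hs => by
        have := H s hs
        simp only [hUd] at this
        linarith)
    simp only [hZd]
    linarith
  have hUZ : ∀ t, U1 t - (-κ * U t + Z t) = Real.exp (-l2 * t) * (b * φ (t - c * h) - g (φ (t - c * h))) := fun t => by
    have h4 := F.eq t
    have h5 := nf_expform h1
    simp only [hU1d, hUd, hZd, h4, hκd]
    linear_combination -Real.exp (-l2 * t) * φ t * h5
  obtain ⟨L, C', HL⟩ := nf_osc (T := min T1 T2) (C := C) (C0 := C0) (σ := σ) (η := η) hU hκ hτ le_rfl hτ hC hσ hZ hZ'
    (fun t ht => by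
      rw [hUZ]
      have := HR t (ht.trans (min_le_left _ _))
      rwa [show -l2 + (l2 + σ) = σ by ring] at this)
    (fun t ht => by
      have := Hv t (ht.trans (min_le_right _ _))
      rwa [show -l2 + (l2 - η) = -η by ring] at this) hη hηθ
  have h3 : EB (fun t => U t - L) σ := ⟨max C' 0, min T1 T2, le_max_right _ _, fun t ht =>
    (HL t ht).trans (mul_le_mul_of_nonneg_right (le_max_left _ _) (Real.exp_pos _).le)⟩
  refine ⟨L, (h3.exp_mul l2).congr fun t => ?_⟩
  have e1 : Real.exp (l2 * t) * Real.exp (-l2 * t) = 1 := by rw [← Real.exp_add]; simp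
  simp only [hUd]
  linear_combination (φ1 t - l1 * φ t) * e1


theorem nf_low {f : ℝ → ℝ} {a l σ : ℝ} (hσ : 0 < σ) (ha : 0 < a)
    (hf : EB (fun t => f t - a * Real.exp (l * t)) (l + σ)) :
    ∃ T, ∀ t ≤ T, a / 2 * Real.exp (l * t) ≤ f t := by
  have h1 := (hf.exp_mul (-l)).tendsto (by linarith)
  have h2 := h1.eventually (lt_mem_nhds (show -(a / 2) < 0 by linarith))
  obtain ⟨T, hT⟩ := eventually_atBot.mp h2
  refine ⟨T, fun t ht => ?_⟩
  have h3 := hT t ht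
  have h4 := mul_le_mul_of_nonneg_left h3.le (Real.exp_pos (l * t)).le
  have e1 : Real.exp (l * t) * Real.exp (-l * t) = 1 := by rw [← Real.exp_add]; simp
  rw [← mul_assoc, e1] at h4
  linarith

theorem nf_uniq {f : ℝ → ℝ} {V V' l s s' : ℝ} (hs : 0 < s) (hs' : 0 < s')
    (h : EB (fun t => f t - V * Real.exp (l * t)) (l + s))
    (h' : EB (fun t => f t - V' * Real.exp (l * t)) (l + s')) : V = V' := by
  have h1 := (h.exp_mul (-l)).tendsto (by linarith)
  have h2 := (h'.exp_mul (-l)).tendsto (by linarith)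
  have h3 := h2.sub h1
  have h4 : Tendsto (fun _ : ℝ => V - V') atBot (nhds (0 - 0)) := by
    refine h3.congr fun t => ?_
    have e1 : Real.exp (l * t) * Real.exp (-l * t) = 1 := by rw [← Real.exp_add]; simp
    linear_combination (V - V') * e1
  have := tendsto_nhds_unique h4 tendsto_const_nhds
  linarith

theorem nf_eta {l2 γ k τ : ℝ} (hl2 : 0 < l2) (hγ : 0 < γ) :
    ∃ η > 0, 0 < l2 - η ∧ l2 < (1 + γ) * (l2 - η) ∧ (1 - Real.exp k / 2) * Real.exp (η * τ) < 1 := by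
  have c1 : Tendsto (fun η : ℝ => l2 - η) (nhds 0) (nhds (l2 - 0)) := Continuous.tendsto (by fun_prop) 0
  have c2 : Tendsto (fun η : ℝ => (1 + γ) * (l2 - η)) (nhds 0) (nhds ((1 + γ) * (l2 - 0))) :=
    Continuous.tendsto (f := fun η : ℝ => (1 + γ) * (l2 - η)) (by fun_prop) 0
  have c3 : Tendsto (fun η : ℝ => (1 - Real.exp k / 2) * Real.exp (η * τ)) (nhds 0)
      (nhds ((1 - Real.exp k / 2) * Real.exp (0 * τ))) :=
    Continuous.tendsto (f := fun η : ℝ => (1 - Real.exp k / 2) * Real.exp (η * τ)) (by fun_prop) 0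
  have e1 := c1.eventually (lt_mem_nhds (show 0 < l2 - 0 by linarith))
  have e2 := c2.eventually (lt_mem_nhds (show l2 < (1 + γ) * (l2 - 0) by nlinarith))
  have e3 := c3.eventually (gt_mem_nhds (show (1 - Real.exp k / 2) * Real.exp (0 * τ) < 1 by
    rw [zero_mul, Real.exp_zero]; have := Real.exp_pos k; linarith))
  have e4 := (e1.and (e2.and e3)).filter_mono (nhdsWithin_le_nhds (s := Ioi 0))
  obtain ⟨η, h1, h2⟩ := (e4.and self_mem_nhdsWithin).exists
  exact ⟨η, h2, h1⟩

theorem nf_perturb {b c h l2 l1 l2' : ℝ} (hb : 0 < b) (hc : 0 ≤ c) (hh : 0 ≤ h) (h12 : l2 < l1)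
    (h2 : chi0 b c h l2 = 0) (h1 : chi0 b c h l1 = 0) (hl2 : 0 < l2') (hl : l2' < l2) :
    ∃ b' l1', 0 < b' ∧ b' < b ∧ l2' < l1' ∧ chi0 b' c h l2' = 0 ∧ chi0 b' c h l1' = 0 := by
  have hE := Real.exp_pos (-(l2' * c * h))
  have e1 : Real.exp (l2' * c * h) * Real.exp (-(l2' * c * h)) = 1 := by rw [← Real.exp_add]; simp
  set b' := (1 + c * l2' - l2' ^ 2) * Real.exp (l2' * c * h) with hb'
  have h3 : chi0 b' c h l2' = 0 := by
    unfold chi0; rw [hb']; linear_combination (1 + c * l2' - l2' ^ 2) * e1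
  have h4 := chi_pos_left hb.le h12 h2 h1 hl
  have hbb : b' < b := by
    unfold chi0 at h3 h4
    have : 0 < (b - b') * Real.exp (-(l2' * c * h)) := by linarith
    have := pos_of_mul_pos_left this hE.le
    linarith
  have hpos : 0 < b' := by
    apply mul_pos _ (Real.exp_pos _)
    have h5 : l2 ^ 2 - c * l2 - 1 < 0 := by
      have := nf_expform h2
      have := mul_pos hb (Real.exp_pos (-(l2 * (c * h))))
      linarith
    by_contra hcon
    have h6 : 0 < l2' - c := by
      by_contra hc2
      nlinarith
    nlinarith
  have h5 : chi0 b' c h l1 < 0 := by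
    have : chi0 b' c h l1 = chi0 b c h l1 - (b - b') * Real.exp (-(l1 * c * h)) := by unfold chi0; ring
    rw [this, h1]
    have := mul_pos (sub_pos.mpr hbb) (Real.exp_pos (-(l1 * c * h)))
    linarith
  obtain ⟨l1', h6, h7⟩ := chi_root1 hpos hc h5
  exact ⟨b', l1', hpos, hbb, by linarith, h3, h7⟩

theorem nf_summary {g : ℝ → ℝ} {c h b A δ γ l2 l1 : ℝ} {φ φ1 φ2 : ℝ → ℝ} (F : NFront g c h φ φ1 φ2)
    (hg : ∀ x, 0 ≤ x → 0 ≤ g x) (hgb : HasDerivAt g b 0) (g0 : g 0 = 0)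
    (hb : 0 < b) (hc : 0 ≤ c) (hh : 0 ≤ h) (hA : 0 ≤ A) (hγ : 0 < γ) (hδ : 0 < δ)
    (hH : ∀ u ∈ Icc 0 δ, |b * u - g u| ≤ A * u ^ γ * u) (hl2 : 0 < l2) (h12 : l2 < l1)
    (h2 : chi0 b c h l2 = 0) (h1 : chi0 b c h l1 = 0) :
    (∃ μ > 0, EB φ μ ∧ EB φ1 μ) ∧ (∃ T, ∀ t ≤ T, 0 < φ1 t) ∧
    (∃ C > 0, ∃ T, ∀ t ≤ T, C * Real.exp (l1 * t) ≤ φ t) ∧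
    ((∃ a > 0, ∃ σ > 0, EB (fun t => φ t - a * Real.exp (l2 * t)) (l2 + σ) ∧
      EB (fun t => φ1 t - l2 * a * Real.exp (l2 * t)) (l2 + σ)) ∨ EB φ l1) := by
  have hτ : 0 ≤ c * h := mul_nonneg hc hh
  obtain ⟨η, hη, hη1, hη2, hη3⟩ := nf_eta (k := -(l1 + l2 - c) * (c * h)) (τ := c * h) hl2 hγ
  obtain ⟨b', l1', hb', hbb, h12', h2', h1'⟩ := nf_perturb hb hc hh h12 h2 h1 hη1 (by linarith)
  obtain ⟨E0, E1⟩ := nf_apriori F hg hgb g0 hb'.le hbb hτ h12' h2' h1'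
  have Ev : EB (fun t => φ1 t - l1 * φ t) (l2 - η) := (E1.lin E0 1 (-l1)).congr fun t => by ring
  set μ0 := l2 - η with hμ0
  have hasym : ∀ μ, μ0 ≤ μ → EB φ μ → ∃ V, EB (fun t => φ1 t - l1 * φ t - V * Real.exp (l2 * t)) (l2 + ((1 + γ) * μ - l2)) := by
    intro μ hμ hE
    have h3 : (1 + γ) * μ0 ≤ (1 + γ) * μ := by gcongr
    refine nf_asym F hb.le hτ h12 (by linarith) h2 h1 ?_ Ev hη.le hη3
    have := nf_holder (τ := c * h) hA hγ hδ hH F.pos (by linarith) hE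
    rwa [show l2 + ((1 + γ) * μ - l2) = (1 + γ) * μ by ring]
  refine ⟨⟨μ0, hη1, E0, E1⟩, ?_⟩
  obtain ⟨V, hV⟩ := hasym μ0 le_rfl E0
  by_cases hV0 : V = 0
  · -- fast
    have hfast : ∀ μ, μ0 ≤ μ → EB φ μ → EB (fun t => φ1 t - l1 * φ t) ((1 + γ) * μ) := by
      intro μ hμ hE
      obtain ⟨V', hV'⟩ := hasym μ hμ hE
      have h3 : (1 + γ) * μ0 ≤ (1 + γ) * μ := by gcongr
      have : V = V' := nf_uniq (f := fun t => φ1 t - l1 * φ t) (by linarith) (by linarith) hV hV'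
      rw [← this, hV0, show l2 + ((1 + γ) * μ - l2) = (1 + γ) * μ by ring] at hV'
      exact hV'.congr fun t => by ring
    obtain ⟨μs, hs1, hs2, hs3⟩ : ∃ μs, μ0 ≤ μs ∧ μs < l1 ∧ l1 < (1 + γ) * μs := by
      have h3 : l1 / (1 + γ) < l1 := div_lt_self (by linarith) (by linarith)
      refine ⟨max ((l1 / (1 + γ) + l1) / 2) μ0, le_max_right _ _, max_lt (by linarith) (by linarith), ?_⟩
      calc l1 = (1 + γ) * (l1 / (1 + γ)) := by field_simp
        _ < (1 + γ) * max ((l1 / (1 + γ) + l1) / 2) μ0 := by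
          apply mul_lt_mul_of_pos_left _ (by linarith)
          exact lt_of_lt_of_le (by linarith) (le_max_left _ _)
    have hind : ∀ n : ℕ, EB φ (min (μ0 + n * (γ * μ0)) μs) := by
      intro n
      induction n with
      | zero => simpa [min_eq_left hs1] using E0
      | succ n ih =>
        have hp : 0 ≤ γ * μ0 := by positivity
        have hge : μ0 ≤ min (μ0 + n * (γ * μ0)) μs := le_min (by have : 0 ≤ (n:ℝ) * (γ * μ0) := by positivity
                                                                 linarith) hs1
        have h3 := hfast _ hge ih
        have hle : min (μ0 + ((n + 1 : ℕ) : ℝ) * (γ * μ0)) μs ≤ (1 + γ) * min (μ0 + n * (γ * μ0)) μs := by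
          have h4 : γ * μ0 ≤ γ * min (μ0 + n * (γ * μ0)) μs := by gcongr
          push_cast
          rcases min_cases (μ0 + n * (γ * μ0)) μs with ⟨h5, h6⟩ | ⟨h5, h6⟩
          · rw [h5] at h4 ⊢
            exact (min_le_left _ _).trans (by linarith)
          · rw [h5] at h4 ⊢
            exact (min_le_right _ _).trans (by linarith)
        exact nf_back F.d1 (lt_of_le_of_lt (min_le_right _ _) hs2) (h3.mono hle)
    have Es : EB φ μs := by
      obtain ⟨n, hn⟩ := exists_nat_gt (μs / (γ * μ0))
      have := hind n
      rw [div_lt_iff₀ (by positivity)] at hn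
      rwa [min_eq_right (by linarith)] at this
    have Ev' := hfast μs hs1 Es
    set μ' := (1 + γ) * μs with hμ'
    obtain ⟨C, T, hC, H⟩ := Ev'.exp_mul (-l1)
    obtain ⟨L, hL⟩ := nf_lim (f := fun t => Real.exp (-l1 * t) * φ t) (T := T) (C := C) (σ := -l1 + μ')
      (fun t => ((nf_exp_deriv (-l1) t).mul (F.d1 t)).congr_deriv
        (show _ = Real.exp (-l1 * t) * (φ1 t - l1 * φ t) by ring)) (by linarith) H
    have hL' : EB (fun t => φ t - L * Real.exp (l1 * t)) (l1 + (-l1 + μ')) := by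
      have h3 : EB (fun t => Real.exp (-l1 * t) * φ t - L) (-l1 + μ') :=
        ⟨C / (-l1 + μ'), T, div_nonneg hC (by linarith), hL⟩
      refine (h3.exp_mul l1).congr fun t => ?_
      have e1 : Real.exp (l1 * t) * Real.exp (-l1 * t) = 1 := by rw [← Real.exp_add]; simp
      linear_combination φ t * e1
    have hL0 : 0 ≤ L := by
      by_contra hcon
      obtain ⟨T, hT⟩ := nf_low (f := fun t => -φ t) (a := -L) (l := l1) (σ := -l1 + μ') (by linarith) (by linarith)
        ((hL'.lin hL' (-1) 0).congr fun t => by ring)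
      have h3 := hT T le_rfl
      have h4 := F.pos T
      have := mul_pos (show 0 < -L / 2 by linarith) (Real.exp_pos (l1 * T))
      linarith
    have hLne : L ≠ 0 := by
      intro hz
      have Eμ' : EB φ μ' := by
        rw [hz, show l1 + (-l1 + μ') = μ' by ring] at hL'
        exact hL'.congr fun t => by ring
      have hd := chi_pos_right hb.le h12 h2 h1 hs3
      set d := chi0 b c h μ' with hdd
      have hb2 : max 0 (b - d / 2) < b := max_lt hb (by linarith)
      obtain ⟨T, Q, hQ, hQ2, hφQ, -⟩ := nf_twoq F hg hgb g0 (le_max_left 0 (b - d / 2)) hb2 hτ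
      have hb3 : b - d / 2 ≤ max 0 (b - d / 2) := le_max_right _ _
      set b2 := max 0 (b - d / 2)
      have hQμ : Q < μ' := by
        by_contra hcon
        push Not at hcon
        have h3 : d ≤ chi0 b c h Q := by
          rcases eq_or_lt_of_le hcon with h4 | h4
          · rw [← h4]
          · have := chi_cvx hb.le c h hs3 h4
            rw [h1, ← hdd] at this
            by_contra hlt
            push Not at hlt
            nlinarith
        have h4 : chi0 b c h Q = chi0 b2 c h Q + (b - b2) * Real.exp (-(Q * c * h)) := by unfold chi0; ring
        have h5 : Real.exp (-(Q * c * h)) ≤ 1 := by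
          apply Real.exp_le_one_iff.mpr
          have : 0 ≤ Q * c * h := by positivity
          linarith
        have h6 : (b - b2) * Real.exp (-(Q * c * h)) ≤ b - b2 := mul_le_of_le_one_right (by linarith) h5
        linarith
      have hd : ∀ s, HasDerivAt (fun s => Real.exp (-Q * s) * φ s) (Real.exp (-Q * s) * (φ1 s - Q * φ s)) s := fun s => by
        refine ((nf_exp_deriv (-Q) s).mul (F.d1 s)).congr_deriv ?_
        ring
      have ha := nf_anti (convex_Iic T) hd (fun s hs => by
        have := hφQ s hs
        have := Real.exp_pos (-Q * s)
        nlinarith)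
      have h3 := (Eμ'.exp_mul (-Q)).tendsto (by linarith)
      have h4 : Real.exp (-Q * T) * φ T ≤ 0 := ge_of_tendsto h3 (by
        filter_upwards [eventually_le_atBot T] with t ht
        exact ha (show t ∈ Iic T from ht) self_mem_Iic ht)
      have := mul_pos (Real.exp_pos (-Q * T)) (F.pos T)
      linarith
    have hLpos : 0 < L := lt_of_le_of_ne hL0 (Ne.symm hLne)
    obtain ⟨T1, hT1⟩ := nf_low (by linarith) hLpos hL'
    have E1' : EB (fun t => φ1 t - (l1 * L) * Real.exp (l1 * t)) (l1 + (-l1 + μ')) := by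
      rw [show l1 + (-l1 + μ') = μ' by ring] at hL' ⊢
      exact (Ev'.lin hL' 1 l1).congr fun t => by ring
    have hl1L : 0 < l1 * L := mul_pos (by linarith) hLpos
    obtain ⟨T2, hT2⟩ := nf_low (by linarith) hl1L E1'
    refine ⟨⟨T2, fun t ht => lt_of_lt_of_le (by positivity) (hT2 t ht)⟩, ⟨L / 2, by linarith, T1, hT1⟩, Or.inr ?_⟩
    exact ((hL'.mono (show l1 ≤ _ by linarith)).lin (EB.exp L l1) 1 1).congr fun t => by ring
  · -- slow
    set a := V / (l2 - l1) with ha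
    have haV : a * (l2 - l1) = V := by rw [ha]; field_simp [show l2 - l1 ≠ 0 by linarith]
    set σ := min ((1 + γ) * μ0 - l2) ((l1 - l2) / 2) with hσ
    have hσ0 : 0 < σ := lt_min (by linarith) (by linarith)
    have hσ1 : σ ≤ (l1 - l2) / 2 := min_le_right _ _
    have hVσ := hV.mono (show l2 + σ ≤ _ from by have : σ ≤ _ := min_le_left _ _
                                                 linarith)
    have Ed : EB (fun t => (φ1 t - a * (l2 * Real.exp (l2 * t))) - l1 * (φ t - a * Real.exp (l2 * t))) (l2 + σ) :=
      hVσ.congr fun t => by rw [← haV]; ring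
    have Ef : EB (fun t => φ t - a * Real.exp (l2 * t)) (l2 + σ) :=
      nf_back (fun t => (F.d1 t).sub ((nf_exp_deriv l2 t).const_mul a)) (by linarith) Ed
    have Ef1 : EB (fun t => φ1 t - l2 * a * Real.exp (l2 * t)) (l2 + σ) :=
      (Ed.lin Ef 1 l1).congr fun t => by ring
    have ha0 : 0 ≤ a := by
      by_contra hcon
      obtain ⟨T, hT⟩ := nf_low (f := fun t => -φ t) (a := -a) (l := l2) (σ := σ) hσ0 (by linarith)
        ((Ef.lin Ef (-1) 0).congr fun t => by ring)
      have h3 := hT T le_rfl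
      have h4 := F.pos T
      have := mul_pos (show 0 < -a / 2 by linarith) (Real.exp_pos (l2 * T))
      linarith
    have hapos : 0 < a := lt_of_le_of_ne ha0 (fun h => hV0 (by rw [← haV, ← h]; ring))
    obtain ⟨T1, hT1⟩ := nf_low hσ0 hapos Ef
    have hl2a : 0 < l2 * a := mul_pos hl2 hapos
    obtain ⟨T2, hT2⟩ := nf_low hσ0 hl2a Ef1
    refine ⟨⟨T2, fun t ht => lt_of_lt_of_le (by positivity) (hT2 t ht)⟩,
      ⟨a / 2, by linarith, min T1 0, fun t ht => ?_⟩, Or.inl ⟨a, hapos, σ, hσ0, Ef, Ef1⟩⟩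
    refine le_trans ?_ (hT1 t (ht.trans (min_le_left _ _)))
    have h0 := ht.trans (min_le_right _ _)
    have : Real.exp (l1 * t) ≤ Real.exp (l2 * t) := Real.exp_le_exp.mpr (by nlinarith)
    gcongr


/-- if `w = z' + m z` attains at `t` its minimum over `[t-τ,t]`, then `w' ≤ d0 w`. -/
theorem nf_FL0 {z z1 z2 : ℝ → ℝ} {c p m τ t : ℝ} (hz : ∀ t, HasDerivAt z (z1 t) t)
    (hp : 0 < p) (hm : 0 < m) (hτ : 0 ≤ τ) (hmeq : m ^ 2 + c * m - 1 = p * Real.exp (m * τ))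
    (H1 : z2 t ≤ c * z1 t + z t + p * z (t - τ))
    (hmin : ∀ s ∈ Icc (t - τ) t, z1 t + m * z t ≤ z1 s + m * z s) :
    z2 t + m * z1 t ≤ (1 + p) / m * (z1 t + m * z t) := by
  set M := z1 t + m * z t with hM
  have h1 := nf_win_lower (m := M) (μ := 0) (l := -m) hz (by linarith) (show t - τ ≤ t by linarith)
    (fun s hs => by
      have := hmin s hs
      rw [zero_mul, Real.exp_zero]; linarith)
  rw [zero_mul, Real.exp_zero, show t - (t - τ) = τ by ring, sub_zero, mul_one] at h1
  have e1 : Real.exp (m * τ) * Real.exp (-m * τ) = 1 := by rw [← Real.exp_add]; simp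
  have h2 := mul_le_mul_of_nonneg_left h1 (show 0 ≤ p * Real.exp (m * τ) by positivity)
  have e2 : p * Real.exp (m * τ) * (z t - Real.exp (-m * τ) * z (t - τ)) = p * Real.exp (m * τ) * z t - p * z (t - τ) := by
    linear_combination -p * z (t - τ) * e1
  have e3 : p * Real.exp (m * τ) * (M * ((Real.exp (-m * τ) - 1) / -m)) = (c + m) * M - (1 + p) / m * M := by
    have hm' := hm.ne'
    clear h1 h2 e2 hmin hM
    clear_value M
    generalize Real.exp (m * τ) = E at *
    generalize Real.exp (-m * τ) = E' at *
    field_simp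
    linear_combination -p * M * e1 - M * hmeq
  rw [e2, e3, ← hmeq] at h2
  have e4 : (c + m) * M = c * z1 t + m * z1 t + (c * m + m ^ 2) * z t := by rw [hM]; ring
  linarith

theorem nf_FL {z z1 z2 : ℝ → ℝ} {c p m τ S l τ0 : ℝ} (hz : ∀ t, HasDerivAt z (z1 t) t)
    (hz1 : ∀ t, HasDerivAt z1 (z2 t) t)
    (hp : 0 < p) (hm : 0 < m) (hτ : 0 ≤ τ) (hmeq : m ^ 2 + c * m - 1 = p * Real.exp (m * τ))
    (H1 : ∀ t ≤ S, z2 t ≤ c * z1 t + z t + p * z (t - τ))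
    (hlim : Tendsto (fun t => z1 t + m * z t) atBot (nhds l)) (hl : 0 ≤ l)
    (hτ0 : z1 τ0 + m * z τ0 < 0) :
    ∀ t, τ0 ≤ t → t ≤ S → (∀ s ≤ t, z1 t + m * z t ≤ z1 s + m * z s) ∧
      z2 t + m * z1 t ≤ (1 + p) / m * (z1 t + m * z t) := by
  intro t ht htS
  have hw : ∀ s, HasDerivAt (fun s => z1 s + m * z s) (z2 s + m * z1 s) s := fun s =>
    (hz1 s).add ((hz s).const_mul m)
  set w := fun s => z1 s + m * z s with hwd
  have hwc : Continuous w := continuous_iff_continuousAt.mpr fun s => (hw s).continuousAt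
  obtain ⟨T, hT⟩ := eventually_atBot.mp (hlim.eventually (lt_mem_nhds (show w τ0 < l from lt_of_lt_of_le hτ0 hl)))
  have hT' : ∀ s ≤ T, w τ0 < w s := hT
  have hTτ : T < τ0 := by
    by_contra hcon
    exact lt_irrefl _ (hT' τ0 (not_lt.mp hcon))
  obtain ⟨x, hx, hmin⟩ := isCompact_Icc.exists_isMinOn (nonempty_Icc.mpr (show T ≤ t by linarith)) hwc.continuousOn
  have hmin' : ∀ s ∈ Icc T t, w x ≤ w s := hmin
  have hxτ : w x ≤ w τ0 := hmin' τ0 ⟨hTτ.le, ht⟩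
  have hall : ∀ s ≤ t, w x ≤ w s := fun s hs => by
    rcases le_total T s with h | h
    · exact hmin' s ⟨h, hs⟩
    · exact hxτ.trans (hT' s h).le
  have hFL := nf_FL0 (t := x) hz hp hm hτ hmeq (H1 x (hx.2.trans htS)) (fun s hs => hall s (hs.2.trans hx.2))
  have hneg : w x < 0 := lt_of_le_of_lt hxτ hτ0
  have hxt : x = t := by
    rcases eq_or_lt_of_le hx.2 with h | h
    · exact h
    · exfalso
      have hd : z2 x + m * z1 x < 0 := by
        have : (1 + p) / m * w x < 0 := mul_neg_of_pos_of_neg (by positivity) hneg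
        linarith
      have h2 := (hasDerivAt_iff_tendsto_slope.mp (hw x)).mono_left
        (nhdsWithin_mono x (show Ioi x ⊆ {x}ᶜ from fun y hy => ne_of_gt hy))
      have h3 := h2.eventually (gt_mem_nhds hd)
      obtain ⟨y, hy, hy2⟩ := (h3.and (Ioo_mem_nhdsGT h)).exists
      rw [slope_def_field, div_lt_iff₀ (by linarith [hy2.1]), zero_mul] at hy
      have := hall y hy2.2.le
      linarith
  subst hxt
  exact ⟨hall, hFL⟩

theorem nf_FL2 {z z1 z2 : ℝ → ℝ} {c p m τ l B : ℝ} (hz : ∀ t, HasDerivAt z (z1 t) t)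
    (hz1 : ∀ t, HasDerivAt z1 (z2 t) t)
    (hp : 0 < p) (hm : 0 < m) (hτ : 0 ≤ τ) (hmeq : m ^ 2 + c * m - 1 = p * Real.exp (m * τ))
    (H1 : ∀ t, z2 t ≤ c * z1 t + z t + p * z (t - τ))
    (hlim : Tendsto (fun t => z1 t + m * z t) atBot (nhds l)) (hl : 0 ≤ l)
    (hB : ∀ t, B ≤ z1 t + m * z t) : ∀ t, 0 ≤ z1 t + m * z t := by
  intro t0
  by_contra hneg
  push Not at hneg
  set d := (1 + p) / m * (z1 t0 + m * z t0) with hd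
  have hd0 : d < 0 := mul_neg_of_pos_of_neg (by positivity) hneg
  have hw : ∀ s, HasDerivAt (fun s => z1 s + m * z s - d * s) (z2 s + m * z1 s - d) s := fun s => by
    refine (((hz1 s).add ((hz s).const_mul m)).sub ((hasDerivAt_id s).const_mul d)).congr_deriv ?_
    ring
  have ha := nf_anti (convex_Ici t0) hw (fun s hs => by
    have hs' : t0 ≤ s := hs
    obtain ⟨h1, h2⟩ := nf_FL (S := s) hz hz1 hp hm hτ hmeq (fun t _ => H1 t) hlim hl hneg s hs' le_rfl
    have h3 := mul_le_mul_of_nonneg_left (h1 t0 hs') (show 0 ≤ (1 + p) / m by positivity)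
    linarith)
  have hx : t0 ≤ t0 + (B - (z1 t0 + m * z t0) - 1) / d := by
    have : 0 ≤ (B - (z1 t0 + m * z t0) - 1) / d := div_nonneg_of_nonpos (by linarith [hB t0]) hd0.le
    linarith
  have h1 := ha self_mem_Ici (show _ ∈ Ici t0 from hx) hx
  simp only at h1
  have h2 := hB (t0 + (B - (z1 t0 + m * z t0) - 1) / d)
  have h3 : d * (t0 + (B - (z1 t0 + m * z t0) - 1) / d) = d * t0 + (B - (z1 t0 + m * z t0) - 1) := by
    rw [mul_add, mul_div_cancel₀ _ hd0.ne]
  linarith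

theorem nf_RL1 {z z1 z2 : ℝ → ℝ} {c p m τ t1 l : ℝ} (hz : ∀ t, HasDerivAt z (z1 t) t)
    (hz1 : ∀ t, HasDerivAt z1 (z2 t) t)
    (hp : 0 < p) (hm : 0 < m) (hτ : 0 ≤ τ) (hmeq : m ^ 2 + c * m - 1 = p * Real.exp (m * τ))
    (H1 : ∀ t ≤ t1 + τ, z2 t ≤ c * z1 t + z t + p * z (t - τ))
    (hlim : Tendsto (fun t => z1 t + m * z t) atBot (nhds l)) (hl : 0 ≤ l)
    (h0 : z t1 = 0) (hpos : ∀ s < t1, 0 < z s) :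
    ∀ t, t1 ≤ t → t ≤ t1 + τ → z1 t < 0 := by
  obtain ⟨τ0, hτ01, hτ0⟩ : ∃ τ0, τ0 ≤ t1 ∧ z1 τ0 + m * z τ0 < 0 := by
    by_contra hcon
    push Not at hcon
    have hd : ∀ s, HasDerivAt (fun s => Real.exp (m * s) * z s) (Real.exp (m * s) * (z1 s + m * z s)) s := fun s => by
      refine ((nf_exp_deriv m s).mul (hz s)).congr_deriv ?_
      ring
    have hmo := nf_mono (convex_Iic t1) hd (fun s hs => mul_nonneg (Real.exp_pos _).le (hcon s hs))
    have h1 := hmo (show t1 - 1 ∈ Iic t1 from by simp) self_mem_Iic (by linarith)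
    simp only at h1
    rw [h0, mul_zero] at h1
    have := mul_pos (Real.exp_pos (m * (t1 - 1))) (hpos (t1 - 1) (by linarith))
    linarith
  intro t ht1 ht2
  obtain ⟨h1, -⟩ := nf_FL hz hz1 hp hm hτ hmeq H1 hlim hl hτ0 t (by linarith) ht2
  have h2 := nf_win_lower (m := z1 t + m * z t) (μ := 0) (l := -m) hz (by linarith) ht1
    (fun s hs => by
      have := h1 s hs.2
      rw [zero_mul, Real.exp_zero]; linarith)
  rw [zero_mul, Real.exp_zero, sub_zero, mul_one, h0, mul_zero, sub_zero] at h2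
  have hneg : z1 t + m * z t < 0 := lt_of_le_of_lt (h1 τ0 (by linarith)) hτ0
  have h3 := mul_le_mul_of_nonneg_left h2 hm.le
  have e : m * ((z1 t + m * z t) * ((Real.exp (-m * (t - t1)) - 1) / -m)) = (z1 t + m * z t) * (1 - Real.exp (-m * (t - t1))) := by
    have := hm.ne'
    field_simp
    ring
  rw [e] at h3
  have h4 := mul_neg_of_neg_of_pos hneg (Real.exp_pos (-m * (t - t1)))
  linarith

theorem nf_RL {z z1 z2 : ℝ → ℝ} {c p m τ T0 l : ℝ} (hz : ∀ t, HasDerivAt z (z1 t) t)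
    (hz1 : ∀ t, HasDerivAt z1 (z2 t) t)
    (hp : 0 < p) (hm : 0 < m) (hτ : 0 ≤ τ) (hmeq : m ^ 2 + c * m - 1 = p * Real.exp (m * τ))
    (hlim : Tendsto (fun t => z1 t + m * z t) atBot (nhds l)) (hl : 0 ≤ l)
    (hT0 : ∀ t ≤ T0, 0 < z t)
    (H1 : ∀ t, 0 ≤ z (t - τ) → z2 t ≤ c * z1 t + z t + p * z (t - τ))
    (H2 : ∀ t, T0 ≤ t - τ → z (t - τ) ≤ 0 → z2 t ≤ c * z1 t + z t)
    (htop : Tendsto z atTop (nhds 0)) : ∀ t, 0 < z t := by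
  intro t
  by_contra hcon
  push Not at hcon
  have hzc : Continuous z := continuous_iff_continuousAt.mpr fun s => (hz s).continuousAt
  have hz1c : Continuous z1 := continuous_iff_continuousAt.mpr fun s => (hz1 s).continuousAt
  obtain ⟨t1, -, h0, hpos⟩ := nf_first_zero hzc hT0 hcon
  have hT01 : T0 < t1 := by
    by_contra h
    have := hT0 t1 (not_lt.mp h)
    linarith
  have hA := nf_RL1 hz hz1 hp hm hτ hmeq (fun t ht => H1 t (by
    rcases eq_or_lt_of_le (show t - τ ≤ t1 by linarith) with h | h
    · rw [h, h0]
    · exact (hpos _ h).le)) hlim hl h0 hpos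
  have hB : ∀ t, t1 ≤ t → z1 t < 0 := by
    intro t ht
    by_contra hc
    push Not at hc
    have htτ : t1 + τ < t := by
      by_contra h
      have := hA t ht (not_lt.mp h)
      linarith
    obtain ⟨t3, h3a, h3b, h3c⟩ := nf_first_zero' hz1c (hA (t1 + τ) (by linarith) le_rfl) htτ.le hc
    have hneg : ∀ s, t1 ≤ s → s ≤ t3 → z1 s ≤ 0 := fun s hs1 hs2 => by
      rcases le_total s (t1 + τ) with h | h
      · exact (hA s hs1 h).le
      · rcases eq_or_lt_of_le hs2 with h' | h'
        · rw [h', h3b]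
        · exact (h3c s h h').le
    have hanti := nf_anti (convex_Icc t1 t3) hz (fun s hs => hneg s hs.1 hs.2)
    have hzneg : ∀ s, t1 ≤ s → s ≤ t3 → z s ≤ 0 := fun s hs1 hs2 => by
      have := hanti (left_mem_Icc.mpr (by linarith)) ⟨hs1, hs2⟩ hs1
      linarith
    have hd : ∀ s, HasDerivAt (fun s => Real.exp (-c * s) * z1 s) (Real.exp (-c * s) * (z2 s - c * z1 s)) s := fun s => by
      refine ((nf_exp_deriv (-c) s).mul (hz1 s)).congr_deriv ?_
      ring
    have ha := nf_anti (convex_Icc (t1 + τ) t3) hd (fun s hs => by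
      have h4 := H2 s (by linarith [hs.1]) (hzneg _ (by linarith [hs.1]) (by linarith [hs.2]))
      have h5 := hzneg s (by linarith [hs.1]) hs.2
      exact mul_nonpos_of_nonneg_of_nonpos (Real.exp_pos _).le (by linarith))
    have h4 := ha (left_mem_Icc.mpr h3a.le) (right_mem_Icc.mpr h3a.le) h3a.le
    simp only at h4
    rw [h3b, mul_zero] at h4
    have := mul_neg_of_pos_of_neg (Real.exp_pos (-c * (t1 + τ))) (hA (t1 + τ) (by linarith) le_rfl)
    linarith
  have hanti := nf_santi (convex_Ici t1) hz (fun s hs => hB s hs)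
  have h1 := hanti self_mem_Ici (show t1 + 1 ∈ Ici t1 from by simp) (by linarith)
  have h2 : 0 ≤ z (t1 + 1) := le_of_tendsto htop (by
    filter_upwards [eventually_ge_atTop (t1 + 1)] with s hs
    exact hanti.antitoneOn (show t1 + 1 ∈ Ici t1 from by simp) (show s ∈ Ici t1 from by simp only [mem_Ici]; linarith) hs)
  linarith

theorem nf_m {c0 c h p : ℝ} (hc0 : 0 < c0) (hcc : c0 ≤ c) (hd : c - c0 ≤ 1 / c) (hh : 0 ≤ h) (hp : 0 < p)
    (hph : p * h * Real.exp (h + 1) ≤ 1) :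
    ∃ m > 0, m ^ 2 + c0 * m - 1 = p * Real.exp (m * (c0 * h)) ∧ p * h * Real.exp (m * c * h) ≤ 1 := by
  have hc : 0 < c := by linarith
  obtain ⟨M, hM0, hM1, hM2⟩ : ∃ M > 0, p * Real.exp (M * (c0 * h)) ≤ M ^ 2 + c0 * M - 1 ∧
      p * h * Real.exp (M * c * h) ≤ 1 := by
    rcases eq_or_lt_of_le hh with h0 | h0
    · refine ⟨1 + p, by linarith, ?_, ?_⟩
      · rw [← h0]; simp; nlinarith
      · rw [← h0]; simp
    · have e : (1 + 1 / h) / c * c * h = h + 1 := by field_simp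
      refine ⟨(1 + 1 / h) / c, by positivity, ?_, by rw [e]; exact hph⟩
      set M := (1 + 1 / h) / c with hM
      have hMp : 0 < M := by positivity
      have h1 : Real.exp (M * (c0 * h)) ≤ Real.exp (h + 1) := by
        apply Real.exp_le_exp.mpr
        rw [← e, mul_assoc]; gcongr
      have h2 : p * Real.exp (h + 1) ≤ 1 / h := by rw [le_div_iff₀ h0]; linarith
      have h3 : c * M = 1 + 1 / h := by rw [hM]; field_simp
      have h4 : 1 / c ≤ M := by
        rw [hM]; gcongr
        have : 0 < 1 / h := by positivity
        linarith
      have h5 := mul_le_mul_of_nonneg_left h1 hp.le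
      have h6 : (c - c0) * M ≤ M * M := by gcongr; linarith
      nlinarith
  have hcont : Continuous fun m : ℝ => m ^ 2 + c0 * m - 1 - p * Real.exp (m * (c0 * h)) := by fun_prop
  obtain ⟨m, hm, hm0⟩ := intermediate_value_Icc hM0.le hcont.continuousOn
    (show (0:ℝ) ∈ Icc _ _ from ⟨by simp; linarith, by linarith⟩)
  simp only at hm0
  refine ⟨m, lt_of_le_of_ne hm.1 ?_, by linarith, ?_⟩
  · rintro rfl
    simp at hm0
    linarith
  · refine le_trans ?_ hM2
    have : m * c * h ≤ M * c * h := by have := hm.2; gcongr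
    have := Real.exp_le_exp.mpr this
    gcongr


structure GC (g : ℝ → ℝ) (κ θ p : ℝ) : Prop where
  nonneg : ∀ x, 0 ≤ x → 0 ≤ g x
  hd : ∀ x, HasDerivAt g (deriv g x) x
  κpos : 0 < κ
  θκ : θ < κ
  ppos : 0 < p
  lip : ∀ x y, 0 ≤ x → x ≤ y → y ≤ κ → -p * (y - x) ≤ g y - g x
  anti : ∀ x y, θ ≤ x → x ≤ y → g y ≤ g x
  fixκ : g κ = κ
  gt : ∀ x, 0 < x → x < κ → x < g x
  dmin : ∀ u ∈ Icc 0 κ, -p ≤ deriv g u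

theorem nf_gt {g : ℝ → ℝ} {κ b : ℝ} (hgb : HasDerivAt g b 0) (g0 : g 0 = 0) (hb : 1 < b) (hg : Continuous g)
    (hfix : ∀ x : ℝ, 0 ≤ x → (g x = x ↔ x = 0 ∨ x = κ)) : ∀ x, 0 < x → x < κ → x < g x := by
  intro x hx hxκ
  by_contra hcon
  push Not at hcon
  obtain ⟨δ, hδ, H⟩ := nf_gb hgb g0 hb
  set y := min δ x with hy
  have hy0 : 0 < y := lt_min hδ hx
  have h1 := H y hy0.le (min_le_left _ _)
  have hc : Continuous fun s => g s - s := by fun_prop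
  obtain ⟨s, hs, hs0⟩ := intermediate_value_Icc' (min_le_right δ x) hc.continuousOn
    (show (0:ℝ) ∈ Icc _ _ from ⟨by linarith, by linarith⟩)
  simp only at hs0
  have hs1 : y ≤ s := hs.1
  have := (hfix s (by linarith)).mp (by linarith)
  rcases this with h | h
  · linarith
  · linarith [hs.2]

theorem nf_d3 {g : ℝ → ℝ} {c h : ℝ} {φ φ1 φ2 : ℝ → ℝ} (F : NFront g c h φ φ1 φ2)
    (hd : ∀ x, HasDerivAt g (deriv g x) x) (t : ℝ) :
    HasDerivAt φ2 (c * φ2 t + φ1 t - deriv g (φ (t - c * h)) * φ1 (t - c * h)) t := by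
  have e : φ2 = fun t => c * φ1 t + φ t - g (φ (t - c * h)) := funext F.eq
  rw [e]
  have h1 : HasDerivAt (fun t => φ (t - c * h)) (φ1 (t - c * h)) t := by
    simpa using HasDerivAt.comp_sub_const t (c * h) (F.d1 (t - c * h))
  have h2 := (hd (φ (t - c * h))).comp t h1
  have := (((F.d2 t).const_mul c).add (F.d1 t)).sub h2
  rw [F.eq t] at this
  exact this

theorem nf_lt {g : ℝ → ℝ} {κ θ p c h m : ℝ} {φ φ1 φ2 : ℝ → ℝ} (G : GC g κ θ p) (F : NFront g c h φ φ1 φ2)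
    (hτ : 0 ≤ c * h) (hm : 0 < m) (hmeq : m ^ 2 + c * m - 1 = p * Real.exp (m * (c * h)))
    (htop : Tendsto φ atTop (nhds κ)) (hl1 : Tendsto φ1 atBot (nhds 0)) : ∀ t, φ t < κ := by
  obtain ⟨T0, hT0⟩ := eventually_atBot.mp (F.lim0.eventually (gt_mem_nhds G.κpos))
  have key := nf_RL (z := fun t => κ - φ t) (z1 := fun t => - φ1 t) (z2 := fun t => - φ2 t)
    (c := c) (p := p) (m := m) (τ := c * h) (T0 := T0) (l := m * κ)
    (fun t => ((hasDerivAt_const t κ).sub (F.d1 t)).congr_deriv (by ring)) (fun t => (F.d2 t).neg)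
    G.ppos hm hτ hmeq (by
      have := hl1.neg.add ((F.lim0.const_sub κ).const_mul m)
      simpa using this) (by have := G.κpos; positivity) (fun t ht => by have := hT0 t ht; linarith)
    (fun t ht => by
      have h1 := G.lip (φ (t - c * h)) κ (F.pos _).le (by linarith) le_rfl
      rw [G.fixκ] at h1
      have := F.eq t
      linarith)
    (fun t _ ht => by
      have h1 := G.anti κ (φ (t - c * h)) G.θκ.le (by linarith)
      rw [G.fixκ] at h1
      have := F.eq t
      linarith)
    (by simpa using htop.const_sub κ)
  intro t
  have := key t
  linarith

theorem nf_mono_front {g : ℝ → ℝ} {κ θ p c h m : ℝ} {φ φ1 φ2 : ℝ → ℝ} (G : GC g κ θ p) (F : NFront g c h φ φ1 φ2)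
    (g0 : g 0 = 0)
    (hc : 0 ≤ c) (hτ : 0 ≤ c * h) (hm : 0 < m) (hmeq : m ^ 2 + c * m - 1 = p * Real.exp (m * (c * h)))
    (htop : Tendsto φ atTop (nhds κ)) (hl1 : Tendsto φ1 atBot (nhds 0))
    (hpos1 : ∃ T, ∀ t ≤ T, 0 < φ1 t) :
    (∀ t, 0 < φ1 t) ∧ ∀ t, 0 ≤ φ2 t + m * φ1 t := by
  have hlt := nf_lt G F hτ hm hmeq htop hl1
  obtain ⟨T0, hT0⟩ := hpos1
  have hφc : Continuous φ := continuous_iff_continuousAt.mpr fun s => (F.d1 s).continuousAt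
  have h1c : Continuous φ1 := continuous_iff_continuousAt.mpr fun s => (F.d2 s).continuousAt
  have hgc : Continuous g := continuous_iff_continuousAt.mpr fun s => (G.hd s).continuousAt
  have hl2 : Tendsto φ2 atBot (nhds 0) := by
    have e : φ2 = fun t => c * φ1 t + φ t - g (φ (t - c * h)) := funext F.eq
    have h1 : Tendsto (fun t => φ (t - c * h)) atBot (nhds 0) :=
      F.lim0.comp (tendsto_atBot_add_const_right _ (-(c * h)) tendsto_id)
    have h2 : Tendsto (fun t => g (φ (t - c * h))) atBot (nhds 0) := by
      have := (hgc.tendsto 0).comp h1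
      rw [g0] at this
      exact this
    rw [e]
    simpa using ((hl1.const_mul c).add F.lim0).sub h2
  have hwlim : Tendsto (fun t => φ2 t + m * φ1 t) atBot (nhds 0) := by
    simpa using hl2.add (hl1.const_mul m)
  have H1 : ∀ t, 0 ≤ φ1 (t - c * h) → c * φ2 t + φ1 t - deriv g (φ (t - c * h)) * φ1 (t - c * h)
      ≤ c * φ2 t + φ1 t + p * φ1 (t - c * h) := fun t ht => by
    have := G.dmin (φ (t - c * h)) ⟨(F.pos _).le, (hlt _).le⟩
    nlinarith
  have hpos : ∀ t, 0 < φ1 t := by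
    intro t
    by_contra hcon
    push Not at hcon
    obtain ⟨t1, -, h0, hb⟩ := nf_first_zero h1c hT0 hcon
    have hA := nf_RL1 F.d2 (nf_d3 F G.hd) G.ppos hm hτ hmeq (fun t ht => H1 t (by
      rcases eq_or_lt_of_le (show t - c * h ≤ t1 by linarith) with h | h
      · rw [h, h0]
      · exact (hb _ h).le)) hwlim le_rfl h0 hb
    -- just after `t1` the derivative is negative
    have hright : ∃ a, t1 < a ∧ ∀ s, t1 < s → s ≤ a → φ1 s < 0 := by
      have h2 := (hasDerivAt_iff_tendsto_slope.mp (F.d2 t1)).mono_left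
        (nhdsWithin_mono t1 (show Ioi t1 ⊆ {t1}ᶜ from fun y hy => ne_of_gt hy))
      have h3 := h2.eventually (gt_mem_nhds (hA t1 le_rfl (by linarith)))
      obtain ⟨a, ha, H⟩ := mem_nhdsGT_iff_exists_Ioc_subset.mp h3
      refine ⟨a, ha, fun s hs1 hs2 => ?_⟩
      have h4 : slope φ1 t1 s < 0 := H ⟨hs1, hs2⟩
      rw [slope_def_field, h0, div_lt_iff₀ (by linarith)] at h4
      linarith
    obtain ⟨a, ha, hneg⟩ := hright
    by_cases hall : ∃ s, a ≤ s ∧ 0 ≤ φ1 s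
    · obtain ⟨s, hs, hs0⟩ := hall
      obtain ⟨t3, h3a, h3b, h3c⟩ := nf_first_zero' h1c (hneg a ha le_rfl) hs hs0
      have hn : ∀ r ∈ Icc t1 t3, φ1 r ≤ 0 := fun r hr => by
        rcases eq_or_lt_of_le hr.1 with h | h
        · rw [← h, h0]
        · rcases eq_or_lt_of_le hr.2 with h' | h'
          · rw [h', h3b]
          · rcases le_total r a with h'' | h''
            · exact (hneg r h h'').le
            · exact (h3c r h'' h').le
      have ht3 : t1 + c * h < t3 := by
        by_contra hh
        push Not at hh
        have hanti := nf_santi (convex_Icc t1 (t1 + c * h)) F.d2 (fun r hr => hA r hr.1 hr.2)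
        have := hanti (left_mem_Icc.mpr (by linarith)) ⟨by linarith, hh⟩ (show t1 < t3 by linarith)
        linarith
      have hanti := nf_anti (convex_Icc t1 t3) F.d1 hn
      have h5 := hanti (show t3 - c * h ∈ Icc t1 t3 from ⟨by linarith, by linarith⟩) (right_mem_Icc.mpr (by linarith)) (by linarith)
      have h6 := G.gt (φ (t3 - c * h)) (F.pos _) (hlt _)
      have h7 := F.eq t3
      rw [h3b] at h7
      obtain ⟨r, hr, hr2⟩ := nf_left_lt (F.d2 t3).neg (by linarith) h3a
      simp only [Pi.neg_apply, h3b] at hr2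
      have := h3c r hr.1.le hr.2
      linarith
    · push Not at hall
      have hn : ∀ r ∈ Ici t1, φ1 r ≤ 0 := fun r hr => by
        rcases eq_or_lt_of_le (show t1 ≤ r from hr) with h | h
        · rw [← h, h0]
        · rcases le_total r a with h'' | h''
          · exact (hneg r h h'').le
          · exact (hall r h'').le
      have hanti := nf_anti (convex_Ici t1) F.d1 hn
      have : κ ≤ φ t1 := le_of_tendsto htop (by
        filter_upwards [eventually_ge_atTop t1] with s hs
        exact hanti self_mem_Ici (show s ∈ Ici t1 from hs) hs)
      linarith [hlt t1]
  refine ⟨hpos, nf_FL2 (B := -(κ + p * κ)) F.d2 (nf_d3 F G.hd) G.ppos hm hτ hmeq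
    (fun t => H1 t (hpos _).le) hwlim le_rfl (fun t => ?_)⟩
  have h1 := hpos t
  have h2 := F.pos t
  have h3 := F.eq t
  have h4 := F.pos (t - c * h)
  have h5 := G.lip (φ (t - c * h)) κ h4.le (hlt _).le le_rfl
  rw [G.fixκ] at h5
  have h6 := mul_nonneg hc h1.le
  have h7 := mul_pos hm h1
  have h8 := mul_pos G.ppos h4
  nlinarith


theorem nf_nu_ex (c : ℝ) : ∃ ν > 0, ν ^ 2 = c * ν + 1 := by
  have hsq : Real.sqrt (c ^ 2 + 4) ^ 2 = c ^ 2 + 4 := Real.sq_sqrt (by positivity)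
  have : -c < Real.sqrt (c ^ 2 + 4) := Real.lt_sqrt_of_sq_lt (by nlinarith)
  exact ⟨(c + Real.sqrt (c ^ 2 + 4)) / 2, by linarith, by nlinarith⟩

theorem nf_super {g : ℝ → ℝ} {κ θ p c c0 h m0 : ℝ} {ψ ψ1 ψ2 : ℝ → ℝ} (G : GC g κ θ p)
    (P : NFront g c0 h ψ ψ1 ψ2) (hc0 : 0 < c0) (hcc : c0 < c) (hh : 0 ≤ h) (hm0 : 0 < m0)
    (hph : p * h * Real.exp (m0 * c * h) ≤ 1) (hψκ : ∀ t, ψ t < κ) (hψ1 : ∀ t, 0 < ψ1 t)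
    (hψm : ∀ t, 0 ≤ ψ2 t + m0 * ψ1 t) (t : ℝ) :
    ψ2 t ≤ c * ψ1 t + ψ t - g (ψ (t - c * h)) := by
  have hd : ∀ s, HasDerivAt (fun s => Real.exp (m0 * s) * ψ1 s) (Real.exp (m0 * s) * (ψ2 s + m0 * ψ1 s)) s := fun s => by
    refine ((nf_exp_deriv m0 s).mul (P.d2 s)).congr_deriv ?_
    ring
  have hmo := nf_mono convex_univ hd (fun s _ => mul_nonneg (Real.exp_pos _).le (hψm s))
  have hle : c0 * h ≤ c * h := by gcongr
  have hτ0 : 0 ≤ c0 * h := by positivity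
  set D := Real.exp (m0 * c * h) * ψ1 t with hD
  have hb : ∀ s ∈ Icc (t - c * h) (t - c0 * h), ψ1 s ≤ D := fun s hs => by
    have h1 := hmo (mem_univ s) (mem_univ t) (by linarith [hs.2])
    simp only at h1
    have h2 := mul_le_mul_of_nonneg_left h1 (Real.exp_pos (-(m0 * s))).le
    rw [← mul_assoc, ← mul_assoc, ← Real.exp_add, ← Real.exp_add, neg_add_cancel, Real.exp_zero, one_mul] at h2
    refine h2.trans ?_
    rw [hD]
    apply mul_le_mul_of_nonneg_right _ (hψ1 t).le
    apply Real.exp_le_exp.mpr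
    have := mul_le_mul_of_nonneg_left hs.1 hm0.le
    linarith
  have ha := nf_anti (F := fun s => ψ s - D * s) (F' := fun s => ψ1 s - D) (convex_Icc (t - c * h) (t - c0 * h)) (fun s => by
    refine ((P.d1 s).sub ((hasDerivAt_id s).const_mul D)).congr_deriv ?_
    ring) (fun s hs => by have := hb s hs; linarith)
  have hij : t - c * h ≤ t - c0 * h := by linarith
  have h1 := ha (left_mem_Icc.mpr hij) (right_mem_Icc.mpr hij) hij
  simp only at h1
  have hψmo := nf_mono convex_univ P.d1 (fun s _ => (hψ1 s).le)
  have h2 := G.lip (ψ (t - c * h)) (ψ (t - c0 * h)) (P.pos _).le (hψmo (mem_univ _) (mem_univ _) hij) (hψκ _).le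
  have h3 := P.eq t
  have h4 : ψ (t - c0 * h) - ψ (t - c * h) ≤ D * ((c - c0) * h) := by linarith
  have h5 := mul_le_mul_of_nonneg_left h4 G.ppos.le
  have h6 : p * (D * ((c - c0) * h)) ≤ (c - c0) * ψ1 t := by
    have := mul_le_mul_of_nonneg_right hph (show 0 ≤ (c - c0) * ψ1 t from mul_nonneg (by linarith) (hψ1 t).le)
    rw [hD]; linarith
  linarith

theorem nf_slide {g : ℝ → ℝ} {κ θ p c c0 h m m0 l1 l0 C T : ℝ} {φ φ1 φ2 ψ ψ1 ψ2 : ℝ → ℝ} (G : GC g κ θ p)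
    (F : NFront g c h φ φ1 φ2)
    (P : NFront g c0 h ψ ψ1 ψ2) (hc0 : 0 < c0) (hcc : c0 < c) (hh : 0 ≤ h)
    (hm : 0 < m) (hmeq : m ^ 2 + c * m - 1 = p * Real.exp (m * (c * h))) (hm0 : 0 < m0)
    (hph : p * h * Real.exp (m0 * c * h) ≤ 1) (hψκ : ∀ t, ψ t < κ) (hφκ : ∀ t, φ t < κ)
    (hψ1 : ∀ t, 0 < ψ1 t) (hψm : ∀ t, 0 ≤ ψ2 t + m0 * ψ1 t)
    (hφtop : Tendsto φ atTop (nhds κ)) (hψtop : Tendsto ψ atTop (nhds κ))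
    (hφ1 : Tendsto φ1 atBot (nhds 0)) (hψ1l : Tendsto ψ1 atBot (nhds 0))
    (hφl : EB φ l1) (hC : 0 < C) (hψl : ∀ t ≤ T, C * Real.exp (l0 * t) ≤ ψ t) (hl : l0 < l1) : False := by
  have hτ : 0 ≤ c * h := mul_nonneg (by linarith) hh
  have hsup := nf_super G P hc0 hcc hh hm0 hph hψκ hψ1 hψm
  have hψmo : Monotone ψ := fun x y hxy =>
    nf_mono convex_univ P.d1 (fun s _ => (hψ1 s).le) (mem_univ x) (mem_univ y) hxy
  have hψc : Continuous ψ := continuous_iff_continuousAt.mpr fun s => (P.d1 s).continuousAt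
  have hφc : Continuous φ := continuous_iff_continuousAt.mpr fun s => (F.d1 s).continuousAt
  have hdom : ∀ s, ∃ T0, ∀ t ≤ T0, φ t < ψ (t + s) := by
    intro s
    have h1 := (hφl.exp_mul (-l0)).tendsto (by linarith)
    have h2 := h1.eventually (gt_mem_nhds (show 0 < C * Real.exp (l0 * s) by positivity))
    obtain ⟨T1, hT1⟩ := eventually_atBot.mp h2
    refine ⟨min T1 (T - s), fun t ht => ?_⟩
    have h3 := hT1 t (ht.trans (min_le_left _ _))
    have h4 := hψl (t + s) (by linarith [ht.trans (min_le_right _ _)])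
    have h5 := mul_lt_mul_of_pos_left h3 (Real.exp_pos (l0 * t))
    have e1 : Real.exp (l0 * t) * Real.exp (-l0 * t) = 1 := by rw [← Real.exp_add]; simp
    rw [← mul_assoc, e1, one_mul] at h5
    rw [mul_add, Real.exp_add] at h4
    linarith
  obtain ⟨tθ, hθ⟩ := (hφtop.eventually (lt_mem_nhds G.θκ)).exists
  set S := {s | ∀ t ≤ tθ, φ t < ψ (t + s)} with hS
  have hSup : ∀ s ∈ S, ∀ s', s ≤ s' → s' ∈ S := fun s hs s' hss t ht =>
    lt_of_lt_of_le (hs t ht) (hψmo (by linarith))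
  have hd1 : ∀ s t, HasDerivAt (fun t => ψ (t + s) - φ t) (ψ1 (t + s) - φ1 t) t := fun s t =>
    (HasDerivAt.comp_add_const t s (P.d1 (t + s))).sub (F.d1 t)
  have hd2 : ∀ s t, HasDerivAt (fun t => ψ1 (t + s) - φ1 t) (ψ2 (t + s) - φ2 t) t := fun s t =>
    (HasDerivAt.comp_add_const t s (P.d2 (t + s))).sub (F.d2 t)
  have hwlim : ∀ s, Tendsto (fun t => (ψ1 (t + s) - φ1 t) + m * (ψ (t + s) - φ t)) atBot (nhds 0) := fun s => by
    have hs : Tendsto (fun t : ℝ => t + s) atBot atBot := tendsto_atBot_add_const_right _ s tendsto_id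
    have := ((hψ1l.comp hs).sub hφ1).add (((P.lim0.comp hs).sub F.lim0).const_mul m)
    simpa using this
  have H1 : ∀ s t, 0 ≤ ψ (t - c * h + s) - φ (t - c * h) →
      ψ2 (t + s) - φ2 t ≤ c * (ψ1 (t + s) - φ1 t) + (ψ (t + s) - φ t) + p * (ψ (t - c * h + s) - φ (t - c * h)) := by
    intro s t ht
    have h1 := hsup (t + s)
    have h2 := F.eq t
    have h3 := G.lip (φ (t - c * h)) (ψ (t - c * h + s)) (F.pos _).le (by linarith) (hψκ _).le
    rw [show t + s - c * h = t - c * h + s by ring] at h1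
    linarith
  have hSpos : ∀ s ∈ S, ∀ t, φ t < ψ (t + s) := by
    intro s hs t
    have key := nf_RL (z := fun t => ψ (t + s) - φ t) (z1 := fun t => ψ1 (t + s) - φ1 t)
      (z2 := fun t => ψ2 (t + s) - φ2 t) (c := c) (p := p) (m := m) (τ := c * h) (T0 := tθ) (l := 0)
      (hd1 s) (hd2 s) G.ppos hm hτ hmeq (hwlim s) le_rfl (fun t ht => by have := hs t ht; linarith)
      (H1 s) (fun t ht1 ht2 => by
        have h1 := hsup (t + s)
        have h2 := F.eq t
        have h3 := hs tθ le_rfl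
        have h4 := hψmo (show tθ + s ≤ t - c * h + s by linarith)
        have h5 := G.anti (ψ (t - c * h + s)) (φ (t - c * h)) (by linarith) (by linarith)
        rw [show t + s - c * h = t - c * h + s by ring] at h1
        linarith) (by
        have hs : Tendsto (fun t : ℝ => t + s) atTop atTop := tendsto_atTop_add_const_right _ s tendsto_id
        simpa using (hψtop.comp hs).sub hφtop) t
    linarith
  have hne : S.Nonempty := by
    obtain ⟨T0, hT0⟩ := hdom 0
    obtain ⟨x, hx, hmax⟩ := isCompact_Icc.exists_isMaxOn (nonempty_Icc.mpr (le_max_left T0 tθ)) hφc.continuousOn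
    have hmax' : ∀ s ∈ Icc T0 (max T0 tθ), φ s ≤ φ x := hmax
    obtain ⟨R, hR⟩ := eventually_atTop.mp (hψtop.eventually (lt_mem_nhds (hφκ x)))
    refine ⟨max 0 (R - T0), fun t ht => ?_⟩
    rcases le_total t T0 with h | h
    · refine lt_of_lt_of_le (hT0 t h) (hψmo ?_)
      have := le_max_left 0 (R - T0)
      linarith
    · have h1 := hmax' t ⟨h, ht.trans (le_max_right _ _)⟩
      refine lt_of_le_of_lt h1 (hR _ ?_)
      have := le_max_right 0 (R - T0)
      linarith
  have hbd : BddBelow S := by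
    obtain ⟨R, hR⟩ := eventually_atBot.mp (P.lim0.eventually (gt_mem_nhds (F.pos tθ)))
    refine ⟨R - tθ, fun s hs => ?_⟩
    by_contra hcon
    have h1 := hR (tθ + s) (by linarith [not_le.mp hcon])
    have h2 := hs tθ le_rfl
    linarith
  set s' := sInf S with hs'
  have hgt : ∀ s, s' < s → s ∈ S := fun s hs => by
    obtain ⟨r, hr, hrs⟩ := exists_lt_of_csInf_lt hne hs
    exact hSup r hr s hrs.le
  have hge : ∀ t, φ t ≤ ψ (t + s') := by
    intro t
    by_contra hcon
    push Not at hcon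
    have hcs : Tendsto (fun s => ψ (t + s)) (nhds s') (nhds (ψ (t + s'))) :=
      (hψc.comp (continuous_const.add continuous_id)).tendsto s'
    have h1 := (hcs.eventually (gt_mem_nhds hcon)).filter_mono (nhdsWithin_le_nhds (s := Ioi s'))
    obtain ⟨s, hs1, hs2⟩ := (h1.and self_mem_nhdsWithin).exists
    have := hSpos s (hgt s hs2) t
    linarith
  obtain ⟨ν, hν0, hν⟩ := nf_nu_ex c
  obtain ⟨ν0, hν00, hν0'⟩ := nf_nu_ex c0
  have hnu := nf_nu F G.nonneg hν0 hν
  have hnu0 := nf_nu P G.nonneg hν00 hν0'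
  have hw := nf_FL2 (B := -(ν * κ)) (hd1 s') (hd2 s') G.ppos hm hτ hmeq
    (fun t => H1 s' t (by have := hge (t - c * h); linarith)) (hwlim s') le_rfl (fun t => by
      have h1 := hge t
      have h2 := hnu t
      have h3 := hψ1 (t + s')
      have h4 := mul_lt_mul_of_pos_left (hφκ t) hν0
      have h5 : 0 ≤ m * (ψ (t + s') - φ t) := mul_nonneg hm.le (by linarith)
      linarith)
  have hzpos : ∀ t, φ t < ψ (t + s') := by
    obtain ⟨T0, hT0⟩ := hdom s'
    intro t
    rcases le_total t T0 with h | h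
    · exact hT0 t h
    · have hd : ∀ s, HasDerivAt (fun s => Real.exp (m * s) * (ψ (s + s') - φ s))
          (Real.exp (m * s) * ((ψ1 (s + s') - φ1 s) + m * (ψ (s + s') - φ s))) s := fun s => by
        refine ((nf_exp_deriv m s).mul (hd1 s' s)).congr_deriv ?_
        ring
      have hmo := nf_mono convex_univ hd (fun s _ => mul_nonneg (Real.exp_pos _).le (hw s))
      have h1 := hmo (mem_univ T0) (mem_univ t) h
      simp only at h1
      have h2 := mul_pos (Real.exp_pos (m * T0)) (sub_pos.mpr (hT0 T0 le_rfl))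
      have h3 := pos_of_mul_pos_right (lt_of_lt_of_le h2 h1) (Real.exp_pos (m * t)).le
      linarith
  obtain ⟨T0, hT0⟩ := hdom (s' - 1)
  have hzc : Continuous fun t => ψ (t + s') - φ t := by fun_prop
  obtain ⟨x, hx, hmin⟩ := isCompact_Icc.exists_isMinOn (nonempty_Icc.mpr (le_max_left T0 tθ)) hzc.continuousOn
  have hmin' : ∀ s ∈ Icc T0 (max T0 tθ), ψ (x + s') - φ x ≤ ψ (s + s') - φ s := hmin
  set d := ψ (x + s') - φ x with hdd
  have hd0 : 0 < d := by have := hzpos x; linarith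
  have hΛ0 : 0 < ν0 * κ := mul_pos hν00 G.κpos
  set Λ := ν0 * κ with hΛ
  set e := min 1 (d / (2 * Λ)) with he
  have he0 : 0 < e := lt_min one_pos (by positivity)
  have he1 : e ≤ 1 := min_le_left _ _
  have he2 : Λ * e ≤ d / 2 := by
    have : e ≤ d / (2 * Λ) := min_le_right _ _
    calc Λ * e ≤ Λ * (d / (2 * Λ)) := by gcongr
      _ = d / 2 := by field_simp
  have hLip : ∀ a b, a ≤ b → ψ b - ψ a ≤ Λ * (b - a) := by
    intro a b hab
    have ha := nf_anti (F := fun s => ψ s - Λ * s) (F' := fun s => ψ1 s - Λ) convex_univ (fun s => by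
      refine ((P.d1 s).sub ((hasDerivAt_id s).const_mul Λ)).congr_deriv ?_
      ring) (fun s _ => by
        have h1 := hnu0 s
        have h2 := mul_lt_mul_of_pos_left (hψκ s) hν00
        linarith) (mem_univ a) (mem_univ b) hab
    simp only at ha
    linarith
  have hmem : s' - e ∈ S := fun t ht => by
    rcases le_total t T0 with h | h
    · exact lt_of_lt_of_le (hT0 t h) (hψmo (by linarith))
    · have h1 := hmin' t ⟨h, ht.trans (le_max_right _ _)⟩
      have h2 := hLip (t + (s' - e)) (t + s') (by linarith)
      rw [show t + s' - (t + (s' - e)) = e by ring] at h2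
      linarith
  have := csInf_le hbd hmem
  linarith

theorem Wavefront.nfront {g : ℝ → ℝ} {κ c h : ℝ} {φ : ℝ → ℝ} (W : Wavefront g κ c h φ) :
    NFront g c h φ (deriv φ) (deriv (deriv φ)) := by
  obtain ⟨hp, hC, he, h0, h1⟩ := W
  have hC' : ContDiff ℝ (1 + 1) φ := by
    have e : (1 + 1 : WithTop ℕ∞) = 2 := by norm_num
    rw [e]; exact hC
  have hd := (contDiff_succ_iff_deriv.mp hC').2.2
  refine ⟨fun t => ?_, fun t => ?_, fun t => ?_, hp, h0⟩
  · exact ((hC.differentiable (by norm_num)) t).hasDerivAt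
  · exact ((hd.differentiable (by norm_num)) t).hasDerivAt
  · have := he t; linarith

theorem nf_holder_pt {g : ℝ → ℝ} {b A δ γ : ℝ} (hd : ∀ x, HasDerivAt g (deriv g x) x) (g0 : g 0 = 0)
    (hA : 0 < A) (hγ : 0 < γ)
    (hH : ∀ u ∈ Icc 0 δ, |deriv g u - b| ≤ A * u ^ γ) :
    ∀ u ∈ Icc 0 δ, |b * u - g u| ≤ A * u ^ γ * u := by
  intro u hu
  have hK : ∀ s ∈ Icc 0 u, |deriv g s - b| ≤ A * u ^ γ := fun s hs =>
    (hH s ⟨hs.1, hs.2.trans hu.2⟩).trans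
      (mul_le_mul_of_nonneg_left (Real.rpow_le_rpow hs.1 hs.2 hγ.le) hA.le)
  set K := A * u ^ γ
  have m1 := nf_mono (F := fun s => g s - b * s + K * s) (F' := fun s => deriv g s - b + K)
    (convex_Icc 0 u)
    (fun s => (((hd s).sub ((hasDerivAt_id s).const_mul b)).add ((hasDerivAt_id s).const_mul K)).congr_deriv
      (by ring))
    (fun s hs => by have := (abs_le.mp (hK s hs)).1; linarith)
  have m2 := nf_mono (F := fun s => b * s + K * s - g s) (F' := fun s => b + K - deriv g s)
    (convex_Icc 0 u)
    (fun s => ((((hasDerivAt_id s).const_mul b).add ((hasDerivAt_id s).const_mul K)).sub (hd s)).congr_deriv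
      (by ring))
    (fun s hs => by have := (abs_le.mp (hK s hs)).2; linarith)
  have a1 := m1 (left_mem_Icc.mpr hu.1) (right_mem_Icc.mpr hu.1) hu.1
  have a2 := m2 (left_mem_Icc.mpr hu.1) (right_mem_Icc.mpr hu.1) hu.1
  simp only [g0, mul_zero] at a1 a2
  rw [abs_le]; constructor <;> linarith

theorem nf_GC {g : ℝ → ℝ} {κ θ : ℝ}
    (hg_nonneg : ∀ x : ℝ, 0 ≤ x → 0 ≤ g x) (hd : ∀ x, HasDerivAt g (deriv g x) x)
    (hg0 : g 0 = 0) (hg'0 : 1 < deriv g 0) (hκ : 0 < κ)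
    (hfix : ∀ x : ℝ, 0 ≤ x → (g x = x ↔ x = 0 ∨ x = κ)) (hθ2 : θ < κ)
    (hUdec : StrictAntiOn g (Ici θ)) (hmin : ∀ u ∈ Icc 0 κ, deriv g κ ≤ deriv g u)
    (hgκ : deriv g κ < 0) : GC g κ θ (-deriv g κ) := by
  have hgc : Continuous g := continuous_iff_continuousAt.mpr fun s => (hd s).continuousAt
  refine ⟨hg_nonneg, hd, hκ, hθ2, by linarith, ?_, ?_, (hfix κ hκ.le).mpr (Or.inr rfl),
    nf_gt (hd 0) hg0 hg'0 hgc hfix, fun u hu => by have := hmin u hu; linarith⟩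
  · intro x y hx hxy hy
    have m1 := nf_mono (F := fun s => g s - deriv g κ * s) (F' := fun s => deriv g s - deriv g κ)
      (convex_Icc 0 κ)
      (fun s => ((hd s).sub ((hasDerivAt_id s).const_mul (deriv g κ))).congr_deriv (by ring))
      (fun s hs => by have := hmin s hs; linarith)
    have := m1 (show x ∈ Icc 0 κ from ⟨hx, hxy.trans hy⟩) (show y ∈ Icc 0 κ from ⟨hx.trans hxy, hy⟩) hxy
    simp only at this
    linarith
  · intro x y hx hxy
    exact hUdec.antitoneOn (mem_Ici.mpr hx) (mem_Ici.mpr (hx.trans hxy)) hxy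

/-- For `h ∈ [0,h_*]` and a non-critical speed `c > c_*(h)`, any wavefront profile of
speed `c` has the linearly determined asymptotics `φ(t+s₀) = e^{λ₂ t} + O(e^{(λ₂+σ)t})`,
`φ'(t+s₀) = λ₂ e^{λ₂ t} + O(e^{(λ₂+σ)t})` as `t → -∞`, where `λ₂` is the smaller positive
root of `χ(·,c) = 0`. -/
theorem noncritical_front_asymptotics
    (g : ℝ → ℝ) (κ θ A δ γ : ℝ)
    (hg_nonneg : ∀ x : ℝ, 0 ≤ x → 0 ≤ g x)
    (hg_C1 : ContDiff ℝ 1 g)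
    (hg0 : g 0 = 0)
    (hg'0 : 1 < deriv g 0)
    (hκ : 0 < κ)
    (hfix : ∀ x : ℝ, 0 ≤ x → (g x = x ↔ x = 0 ∨ x = κ))
    (hθ1 : 0 < θ) (hθ2 : θ < κ)
    (hUinc : StrictMonoOn g (Ico 0 θ))
    (hUdec : StrictAntiOn g (Ici θ))
    (hmin : ∀ u ∈ Icc 0 κ, deriv g κ ≤ deriv g u)
    (hgκ : deriv g κ < 0)
    (hA : 0 < A) (hδ1 : 0 < δ) (hδ2 : δ < θ) (hγ1 : 0 < γ) (hγ2 : γ ≤ 1)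
    (hHolder : ∀ u ∈ Icc 0 δ, |deriv g u - deriv g 0| ≤ A * u ^ γ)
    (hs : ℝ) (hs_pos : 0 < hs)
    (hs_eq : 1 = |deriv g κ| * hs * Real.exp (hs + 1))
    (hs_unique : ∀ h' : ℝ, 1 = |deriv g κ| * h' * Real.exp (h' + 1) → h' = hs)
    (h : ℝ) (hh : h ∈ Icc 0 hs)
    (cstar : ℝ)
    (hcstar : ∀ c' : ℝ, (∃ φ : ℝ → ℝ, Wavefront g κ c' h φ) ↔ cstar ≤ c')
    (c : ℝ) (hc : cstar < c)
    (lam2 : ℝ) (hlam2_pos : 0 < lam2)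
    (hlam2_root : chi0 (deriv g 0) c h lam2 = 0)
    (hlam2_min : ∀ z : ℝ, 0 < z → chi0 (deriv g 0) c h z = 0 → lam2 ≤ z) :
    ∀ φ : ℝ → ℝ, Wavefront g κ c h φ →
      ∃ s0 σ : ℝ, 0 < σ ∧
        ((fun t => φ (t + s0) - Real.exp (lam2 * t)) =O[atBot]
          fun t => Real.exp ((lam2 + σ) * t)) ∧
        ((fun t => deriv φ (t + s0) - lam2 * Real.exp (lam2 * t)) =O[atBot]
          fun t => Real.exp ((lam2 + σ) * t)) := by
  intro φ W
  have hd : ∀ x, HasDerivAt g (deriv g x) x := fun x =>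
    ((hg_C1.differentiable (by norm_num)) x).hasDerivAt
  have G := nf_GC hg_nonneg hd hg0 hg'0 hκ hfix hθ2 hUdec hmin hgκ
  have hH := nf_holder_pt hd hg0 hA hγ1 hHolder
  have hh0 : 0 ≤ h := hh.1
  have hp : 0 < -deriv g κ := by linarith
  have hph : -deriv g κ * h * Real.exp (h + 1) ≤ 1 := by
    rw [abs_of_neg hgκ] at hs_eq
    refine le_of_le_of_eq ?_ hs_eq.symm
    have h1 : Real.exp (h + 1) ≤ Real.exp (hs + 1) := Real.exp_le_exp.mpr (by linarith [hh.2])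
    exact mul_le_mul (mul_le_mul_of_nonneg_left hh.2 hp.le) h1 (Real.exp_pos _).le (by positivity)
  have hcpos : 0 < c := by
    by_contra hcn
    push Not at hcn
    have e : (1:ℝ) ≤ Real.exp (-(lam2 * c * h)) := by
      apply Real.one_le_exp
      have : lam2 * c * h ≤ 0 :=
        mul_nonpos_of_nonpos_of_nonneg (mul_nonpos_of_nonneg_of_nonpos hlam2_pos.le hcn) hh0
      linarith
    unfold chi0 at hlam2_root
    have e2 : c * lam2 ≤ 0 := mul_nonpos_of_nonpos_of_nonneg hcn hlam2_pos.le
    nlinarith [sq_nonneg lam2]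
  have hinv : 0 < 1 / c := by positivity
  obtain ⟨c0, hc0a, hc0c⟩ := exists_between
    (show max (max cstar 0) (c - 1 / c) < c from max_lt (max_lt hc hcpos) (by linarith))
  have hc0b : max cstar 0 < c0 := lt_of_le_of_lt (le_max_left _ _) hc0a
  have hc0d : c - 1 / c < c0 := lt_of_le_of_lt (le_max_right _ _) hc0a
  obtain ⟨c00, hc00a, hc00c⟩ := exists_between hc0b
  have hc00s : cstar ≤ c00 := (le_max_left _ _).trans hc00a.le
  have hc00p : 0 < c00 := lt_of_le_of_lt (le_max_right _ _) hc00a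
  have hc0p : 0 < c0 := hc00p.trans hc00c
  obtain ⟨ω, Wω⟩ := (hcstar c00).mpr hc00s
  obtain ⟨ψ, Wψ⟩ := (hcstar c0).mpr (hc00s.trans hc00c.le)
  have F := W.nfront
  have P := Wψ.nfront
  have hb0 : 0 < deriv g 0 := by linarith
  obtain ⟨z, hz, hz0⟩ := nf_chi_nonpos Wω.nfront hg_nonneg (hd 0) hg0 hg'0 hc00p.le hh0
  have hz1 : chi0 (deriv g 0) c0 h z < 0 := lt_of_lt_of_le (chi_mono_c hb0.le hh0 hz hc00c) hz0
  have hz2 : chi0 (deriv g 0) c h z < 0 := (chi_mono_c hb0.le hh0 hz hc0c).trans hz1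
  obtain ⟨k1, hk1z, hk1⟩ := chi_root1 hb0 hc0p.le hz1
  obtain ⟨k2, hk2p, hk2z, hk2⟩ := chi_root2 hg'0 hz hz1
  obtain ⟨l1, hl1z, hl1⟩ := chi_root1 hb0 hcpos.le hz2
  obtain ⟨l2, hl2p, hl2z, hl2⟩ := chi_root2 hg'0 hz hz2
  have hlz : lam2 < z := lt_of_le_of_lt (hlam2_min l2 hl2p hl2) hl2z
  have hll : lam2 < l1 := hlz.trans hl1z
  have hkl : k1 < l1 := by
    have h1 := chi_mono_c hb0.le hh0 (hz.trans hk1z) hc0c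
    rw [hk1] at h1
    by_contra hcon
    rcases eq_or_lt_of_le (not_lt.mp hcon) with e | e
    · rw [← e, hl1] at h1; exact lt_irrefl _ h1
    · exact absurd (chi_pos_right hb0.le hll hlam2_root hl1 e) (by linarith)
  obtain ⟨⟨μ, hμ, -, Eφ⟩, -, -, hcase⟩ := nf_summary F hg_nonneg (hd 0) hg0 hb0 hcpos.le hh0 hA.le hγ1 hδ1 hH
    hlam2_pos hll hlam2_root hl1
  obtain ⟨⟨ν, hν, -, Eψ⟩, hψpos, ⟨C, hC, T, hCT⟩, -⟩ := nf_summary P hg_nonneg (hd 0) hg0 hb0 hc0p.le hh0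
    hA.le hγ1 hδ1 hH hk2p (hk2z.trans hk1z) hk2 hk1
  have hφ1 := Eφ.tendsto hμ
  have hψ1 := Eψ.tendsto hν
  rcases hcase with ⟨a, ha, σ, hσ, E0, E1⟩ | E
  · have key : ∀ t, a * Real.exp (lam2 * (t + -(Real.log a) / lam2)) = Real.exp (lam2 * t) := by
      intro t
      have e : lam2 * (t + -(Real.log a) / lam2) = lam2 * t - Real.log a := by field_simp; ring
      rw [e, Real.exp_sub, Real.exp_log ha]; field_simp
    refine ⟨-(Real.log a) / lam2, σ, hσ, ?_, ?_⟩
    · exact ((E0.shift (-(Real.log a) / lam2)).congr fun t => by rw [key]).isBigO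
    · exact ((E1.shift (-(Real.log a) / lam2)).congr fun t => by rw [mul_assoc, key]).isBigO
  · exfalso
    obtain ⟨m, hm, hmeq, -⟩ := nf_m hcpos le_rfl (by linarith) hh0 hp hph
    obtain ⟨m0, hm0, hm0eq, hm0p⟩ := nf_m hc0p hc0c.le (by linarith) hh0 hp hph
    have hφtop := W.2.2.2.2
    have hψtop := Wψ.2.2.2.2
    have hτ : 0 ≤ c * h := mul_nonneg hcpos.le hh0
    have hτ0 : 0 ≤ c0 * h := mul_nonneg hc0p.le hh0
    have hφκ := nf_lt G F hτ hm hmeq hφtop hφ1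
    have hψκ := nf_lt G P hτ0 hm0 hm0eq hψtop hψ1
    obtain ⟨hψ1p, hψm⟩ := nf_mono_front G P hg0 hc0p.le hτ0 hm0 hm0eq hψtop hψ1 hψpos
    exact nf_slide G F P hc0p hc0c hh0 hm hmeq hm0 hm0p hψκ hφκ hψ1p hψm hφtop hψtop hφ1 hψ1 E hC hCT hkl
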